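/- (Nonnegativity of the fractional derivative of the density.) Let 0 < β < 1, T > 0, d ≥ 1. Let v : [0,T]×ℝ^d → ℝ^d be continuous, ℤ^d-periodic in x, and Lipschitz in x uniformly in t, and let m be a classical solution on [0,T] of the time-fractional Fokker–Planck equation ∂_t m(t,x) = Δ_x μ(t,x) + div_x( v(t,x) μ(t,x) ), where μ(t,x) := D^{1−β}_{(0,t]}m(·,x)(t). If m(0,·) ≥ 0 and ∫_{[0,1]^d} m(0,x) dx = 1, then D^{1−β}_{(0,t]}m(·,x)(t) ≥ 0 for all t ∈ (0,T) and all x ∈ ℝ^d. -/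

import Mathlib

open MeasureTheory Set
open scoped ENNReal

/-- Forward Riemann–Liouville fractional integral of order `β`. -/
noncomputable def rlInt (β : ℝ) (φ : ℝ → ℝ) (t : ℝ) : ℝ :=
  (Real.Gamma β)⁻¹ * ∫ τ in Set.Ioo 0 t, (t - τ) ^ (β - 1) * φ τ

/-- Forward Riemann–Liouville derivative in time of order `1-β` of `m(·,x)`:
`D^{1-β}_{(0,t]} m(·,x)(t) = (d/dt)[I^β_{(0,·]} m(·,x)](t)`. -/
noncomputable def fracD (β : ℝ) {d : ℕ} (m : ℝ → (Fin d → ℝ) → ℝ)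
    (t : ℝ) (x : Fin d → ℝ) : ℝ :=
  deriv (fun s => rlInt β (fun τ => m τ x) s) t

/-- Partial derivative in the `i`-th spatial coordinate. -/
noncomputable def pderiv {d : ℕ} (f : (Fin d → ℝ) → ℝ) (i : Fin d) (x : Fin d → ℝ) : ℝ :=
  deriv (fun s => f (Function.update x i s)) (x i)

/-- Laplacian in space: `Δf = ∑ i ∂²f/∂x_i²`. -/
noncomputable def lapl {d : ℕ} (f : (Fin d → ℝ) → ℝ) (x : Fin d → ℝ) : ℝ :=
  ∑ i, pderiv (pderiv f i) i x

/-- Divergence in space of a vector field. -/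
noncomputable def diverg {d : ℕ} (V : (Fin d → ℝ) → Fin d → ℝ) (x : Fin d → ℝ) : ℝ :=
  ∑ i, pderiv (fun y => V y i) i x

/-- `ℤ^d`-periodicity (representation of functions on the flat torus `𝕋^d`). -/
def ZPeriodic {d : ℕ} (g : (Fin d → ℝ) → ℝ) : Prop :=
  ∀ (z : Fin d → ℤ) (x : Fin d → ℝ), g (x + fun i => (z i : ℝ)) = g x

/-- A classical solution `m` on `[0,T]` of the time-fractional Fokker–Planck equation
`∂_t m = Δ_x μ + div_x (v μ)`, `μ(t,x) = D^{1-β}_{(0,t]} m(·,x)(t)`: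
`m` is continuous, `ℤ^d`-periodic in `x`, `C¹` in `t` on `(0,T)` with `∂_t m` continuous,
`μ` exists on `(0,T)` and is continuous together with its first and second spatial
partial derivatives, and the equation holds pointwise on `(0,T) × ℝ^d`. -/
structure IsFPSolution (β T : ℝ) {d : ℕ}
    (v : ℝ → (Fin d → ℝ) → Fin d → ℝ) (m : ℝ → (Fin d → ℝ) → ℝ) : Prop where
  cont : Continuous fun p : ℝ × (Fin d → ℝ) => m p.1 p.2
  periodic : ∀ t, ZPeriodic (m t)
  tdiff : ∀ x, ∀ t ∈ Set.Ioo 0 T, DifferentiableAt ℝ (fun s => m s x) t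
  tderiv_cont : ContinuousOn (fun p : ℝ × (Fin d → ℝ) => deriv (fun s => m s p.2) p.1)
    (Set.Ioo 0 T ×ˢ Set.univ)
  mu_exists : ∀ x, ∀ t ∈ Set.Ioo 0 T, DifferentiableAt ℝ (rlInt β fun τ => m τ x) t
  mu_cont : ContinuousOn (fun p : ℝ × (Fin d → ℝ) => fracD β m p.1 p.2)
    (Set.Ioo 0 T ×ˢ Set.univ)
  mu_cont1 : ∀ i, ContinuousOn (fun p : ℝ × (Fin d → ℝ) => pderiv (fracD β m p.1) i p.2)
    (Set.Ioo 0 T ×ˢ Set.univ)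
  mu_cont2 : ∀ i j, ContinuousOn
    (fun p : ℝ × (Fin d → ℝ) => pderiv (pderiv (fracD β m p.1) j) i p.2)
    (Set.Ioo 0 T ×ˢ Set.univ)
  eqn : ∀ t ∈ Set.Ioo 0 T, ∀ x, deriv (fun s => m s x) t =
    lapl (fracD β m t) x + diverg (fun y i => v t y i * fracD β m t y) x

section RiemannLiouville

open Filter Topology ProbabilityTheory

/-- The unnormalised Riemann–Liouville integral of order `p` based at `a`. -/
noncomputable def rlConv (p a : ℝ) (g : ℝ → ℝ) (t : ℝ) : ℝ :=
  ∫ r in a..t, (t - r) ^ (p - 1) * g r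

theorem integral_sub_rpow_mul_sub_rpow {p q s t : ℝ} (hp : 0 < p) (hq : 0 < q) (hst : s < t) :
    ∫ r in s..t, (t - r) ^ (p - 1) * (r - s) ^ (q - 1) = (t - s) ^ (p + q - 1) * beta p q := by
  have hpos : 0 < t - s := sub_pos.2 hst
  have h := Complex.betaIntegral_scaled (q : ℂ) (p : ℂ) hpos
  have h1 : ∫ r in s..t, (t - r) ^ (p - 1) * (r - s) ^ (q - 1)
      = ∫ x in (0 : ℝ)..(t - s), x ^ (q - 1) * ((t - s) - x) ^ (p - 1) := by
    have := intervalIntegral.integral_comp_sub_right (a := s) (b := t)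
      (fun x => x ^ (q - 1) * ((t - s) - x) ^ (p - 1)) s
    rw [sub_self] at this
    rw [← this]
    refine intervalIntegral.integral_congr fun r _ => ?_
    rw [mul_comm]
    congr 2
    ring
  have h2 : ∫ x in (0 : ℝ)..(t - s),
        (x : ℂ) ^ ((q : ℂ) - 1) * (((t - s : ℝ) : ℂ) - x) ^ ((p : ℂ) - 1)
      = ((∫ x in (0 : ℝ)..(t - s), x ^ (q - 1) * ((t - s) - x) ^ (p - 1) : ℝ) : ℂ) := by
    rw [← intervalIntegral.integral_ofReal]
    refine intervalIntegral.integral_congr fun r hr => ?_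
    rw [uIcc_of_le hpos.le] at hr
    rw [Complex.ofReal_mul, Complex.ofReal_cpow hr.1, Complex.ofReal_cpow (by linarith [hr.2])]
    push_cast
    ring
  rw [h2] at h
  have h3 := congrArg Complex.re h
  rw [Complex.ofReal_re] at h3
  have h4 : ((t - s : ℝ) : ℂ) ^ ((q : ℂ) + p - 1) = (((t - s) ^ (p + q - 1) : ℝ) : ℂ) := by
    rw [Complex.ofReal_cpow hpos.le]
    push_cast
    ring_nf
  rw [h4, Complex.re_ofReal_mul, ← beta_eq_betaIntegralReal q p hq hp] at h3
  rw [h1, h3, beta, beta, mul_comm (Real.Gamma q), add_comm q p]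

theorem intervalIntegrable_sub_rpow_mul_sub_rpow {p q s t : ℝ} (hp : 0 < p) (hq : 0 < q)
    (hst : s < t) :
    IntervalIntegrable (fun r => (t - r) ^ (p - 1) * (r - s) ^ (q - 1)) volume s t := by
  by_contra h
  have h1 := integral_sub_rpow_mul_sub_rpow hp hq hst
  rw [intervalIntegral.integral_undef h] at h1
  exact (mul_pos (Real.rpow_pos_of_pos (sub_pos.2 hst) _) (beta_pos hp hq)).ne h1

theorem beta_comm (p q : ℝ) : beta p q = beta q p := by
  rw [beta, beta, mul_comm (Real.Gamma q), add_comm q p]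

theorem intervalIntegrable_sub_rpow {p : ℝ} (hp : 0 < p) (t a b : ℝ) :
    IntervalIntegrable (fun r => (t - r) ^ (p - 1)) volume a b := by
  have := (intervalIntegral.intervalIntegrable_rpow' (a := t - a) (b := t - b)
    (by linarith : -1 < p - 1)).comp_sub_left t
  simpa using this

theorem intervalIntegrable_sub_rpow_mul {p : ℝ} (hp : 0 < p) {g : ℝ → ℝ} {t a b : ℝ}
    (hg : ContinuousOn g (uIcc a b)) :
    IntervalIntegrable (fun r => (t - r) ^ (p - 1) * g r) volume a b :=
  (intervalIntegrable_sub_rpow hp t a b).mul_continuousOn hg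

theorem integral_sub_rpow {p : ℝ} (hp : 0 < p) {a b t : ℝ} :
    ∫ r in a..b, (t - r) ^ (p - 1) = ((t - a) ^ p - (t - b) ^ p) / p := by
  rw [intervalIntegral.integral_comp_sub_left (fun x => x ^ (p - 1)) t,
    integral_rpow (Or.inl (by linarith))]
  simp

theorem rlConv_one (a : ℝ) (g : ℝ → ℝ) (t : ℝ) : rlConv 1 a g t = ∫ r in a..t, g r := by
  simp [rlConv]

theorem rlConv_congr {p a : ℝ} {g h : ℝ → ℝ} {t : ℝ} (hat : a ≤ t)
    (H : ∀ r ∈ Icc a t, g r = h r) : rlConv p a g t = rlConv p a h t := by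
  refine intervalIntegral.integral_congr fun r hr => ?_
  rw [uIcc_of_le hat] at hr
  simp only [H r hr]

theorem rlConv_add {p a t : ℝ} (hp : 0 < p) {g h : ℝ → ℝ} (hg : Continuous g)
    (hh : Continuous h) :
    rlConv p a (fun r => g r + h r) t = rlConv p a g t + rlConv p a h t := by
  unfold rlConv
  rw [← intervalIntegral.integral_add (intervalIntegrable_sub_rpow_mul hp hg.continuousOn)
    (intervalIntegrable_sub_rpow_mul hp hh.continuousOn)]
  simp only [mul_add]

theorem rlConv_const_mul {p a t c : ℝ} {g : ℝ → ℝ} :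
    rlConv p a (fun r => c * g r) t = c * rlConv p a g t := by
  unfold rlConv
  rw [← intervalIntegral.integral_const_mul]
  congr 1
  ext r
  ring

theorem rlConv_const {p a t c : ℝ} (hp : 0 < p) :
    rlConv p a (fun _ => c) t = c * ((t - a) ^ p / p) := by
  unfold rlConv
  rw [intervalIntegral.integral_mul_const, integral_sub_rpow hp]
  simp [Real.zero_rpow hp.ne', mul_comm]

/-- Riemann–Liouville integral of a truncated power. -/
theorem rlConv_max_rpow {p q b : ℝ} (hp : 0 < p) (hq : 0 < q) (hb : 0 ≤ b) {t : ℝ} (ht : 0 ≤ t) :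
    rlConv p 0 (fun r => (max (r - b) 0) ^ q) t = beta p (q + 1) * (max (t - b) 0) ^ (p + q) := by
  have hcont : Continuous fun r : ℝ => (max (r - b) 0) ^ q :=
    (Real.continuous_rpow_const hq.le).comp (by fun_prop)
  have hzero : ∀ c ≤ b, 0 ≤ c → ∫ r in (0 : ℝ)..c, (t - r) ^ (p - 1) * (max (r - b) 0) ^ q = 0 := by
    intro c hc hc0
    rw [intervalIntegral.integral_congr (g := fun _ => (0 : ℝ)), intervalIntegral.integral_zero]
    intro r hr
    rw [uIcc_of_le hc0] at hr
    simp only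
    rw [max_eq_right (by linarith [hr.2]), Real.zero_rpow hq.ne', mul_zero]
  rcases le_or_gt t b with h | h
  · rw [rlConv, hzero t h ht, max_eq_right (by linarith), Real.zero_rpow (by linarith), mul_zero]
  · rw [rlConv, ← intervalIntegral.integral_add_adjacent_intervals
      (intervalIntegrable_sub_rpow_mul hp hcont.continuousOn (a := 0) (b := b))
      (intervalIntegrable_sub_rpow_mul hp hcont.continuousOn), hzero b le_rfl hb, zero_add,
      max_eq_left (by linarith)]
    have := integral_sub_rpow_mul_sub_rpow hp (by linarith : 0 < q + 1) h
    rw [add_sub_cancel_right] at this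
    rw [mul_comm, show p + q = p + (q + 1) - 1 by ring, ← this]
    refine intervalIntegral.integral_congr fun r hr => ?_
    rw [uIcc_of_le h.le] at hr
    rw [max_eq_left (by linarith [hr.1])]

/-- The semigroup property of Riemann–Liouville integrals. -/
theorem rlConv_rlConv {p q a t : ℝ} (hp : 0 < p) (hq : 0 < q) (hat : a ≤ t) {g : ℝ → ℝ}
    (hg : Continuous g) : rlConv p a (rlConv q a g) t = beta p q * rlConv (p + q) a g t := by
  set F : ℝ → ℝ → ℝ := fun r s =>
    (t - r) ^ (p - 1) * ((Ioi s).indicator (fun r => (r - s) ^ (q - 1)) r * g s) with hF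
  have hmeas : Measurable (Function.uncurry F) := by
    have : Function.uncurry F = fun z : ℝ × ℝ => (t - z.1) ^ (p - 1) *
        ({z : ℝ × ℝ | z.2 < z.1}.indicator (fun z => (z.1 - z.2) ^ (q - 1)) z * g z.2) := by
      ext ⟨r, s⟩
      simp [hF, Function.uncurry, indicator]
    rw [this]
    refine Measurable.mul (by fun_prop) (Measurable.mul ?_ (hg.measurable.comp measurable_snd))
    exact Measurable.indicator (by fun_prop) (measurableSet_lt measurable_snd measurable_fst)
  have hFs : ∀ s ∈ Ioo a t, ∀ c : ℝ → ℝ → ℝ,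
      (∀ s r, c s r = (t - r) ^ (p - 1) * (r - s) ^ (q - 1)) →
      ∀ r, (t - r) ^ (p - 1) * (Ioi s).indicator (fun r => (r - s) ^ (q - 1)) r
        = (Ioi s).indicator (c s) r := by
    intro s _ c hc r
    by_cases hr : r ∈ Ioi s
    · rw [indicator_of_mem hr, indicator_of_mem hr, hc]
    · rw [indicator_of_notMem hr, indicator_of_notMem hr, mul_zero]
  have hinter : ∀ s ∈ Ioo a t, Ioc a t ∩ Ioi s = Ioc s t := by
    intro s hs
    ext r
    simp only [mem_inter_iff, mem_Ioc, mem_Ioi]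
    constructor
    · rintro ⟨⟨_, h⟩, h'⟩; exact ⟨h', h⟩
    · rintro ⟨h', h⟩; exact ⟨⟨hs.1.trans h', h⟩, h'⟩
  have hFeq : ∀ s ∈ Ioo a t, ∀ r, F r s =
      (Ioi s).indicator (fun r => (t - r) ^ (p - 1) * (r - s) ^ (q - 1)) r * g s := by
    intro s hs r
    rw [← hFs s hs (fun s r => (t - r) ^ (p - 1) * (r - s) ^ (q - 1)) (fun _ _ => rfl) r, hF]
    ring
  have hinteg : ∀ s ∈ Ioo a t, IntegrableOn
      ((Ioi s).indicator (fun r => (t - r) ^ (p - 1) * (r - s) ^ (q - 1))) (Ioc a t) := by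
    intro s hs
    rw [IntegrableOn, integrable_indicator_iff measurableSet_Ioi, IntegrableOn,
      Measure.restrict_restrict measurableSet_Ioi, inter_comm, hinter s hs]
    exact (intervalIntegrable_iff_integrableOn_Ioc_of_le hs.2.le).1
      (intervalIntegrable_sub_rpow_mul_sub_rpow hp hq hs.2)
  have hval : ∀ s ∈ Ioo a t, ∫ r in Ioc a t,
      (Ioi s).indicator (fun r => (t - r) ^ (p - 1) * (r - s) ^ (q - 1)) r
        = (t - s) ^ (p + q - 1) * beta p q := by
    intro s hs
    rw [integral_indicator measurableSet_Ioi, Measure.restrict_restrict measurableSet_Ioi,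
      inter_comm, hinter s hs, ← intervalIntegral.integral_of_le hs.2.le,
      integral_sub_rpow_mul_sub_rpow hp hq hs.2]
  have hae : ∀ᵐ s ∂(volume.restrict (Ioc a t)), s ∈ Ioo a t := by
    rw [← restrict_Ioo_eq_restrict_Ioc]
    exact ae_restrict_mem measurableSet_Ioo
  have hFint : Integrable (Function.uncurry F)
      ((volume.restrict (Ioc a t)).prod (volume.restrict (Ioc a t))) := by
    rw [integrable_prod_iff' hmeas.aestronglyMeasurable]
    constructor
    · filter_upwards [hae] with s hs
      refine ((hinteg s hs).mul_const (g s)).congr ?_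
      exact Eventually.of_forall fun r => (hFeq s hs r).symm
    · have h1 : IntegrableOn (fun s => (t - s) ^ (p + q - 1) * (beta p q * |g s|)) (Ioc a t) :=
        (intervalIntegrable_iff_integrableOn_Ioc_of_le hat).1
          (intervalIntegrable_sub_rpow_mul (by linarith)
            (Continuous.continuousOn (by fun_prop)))
      refine h1.congr ?_
      filter_upwards [hae] with s hs
      rw [← mul_assoc, ← hval s hs, ← integral_mul_const]
      refine setIntegral_congr_fun measurableSet_Ioc fun r hr => ?_
      simp only [Function.uncurry]
      rw [hFeq s hs r, norm_mul, Real.norm_eq_abs (g s), Real.norm_of_nonneg]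
      by_cases h : r ∈ Ioi s
      · rw [indicator_of_mem h]
        exact mul_nonneg (Real.rpow_nonneg (by linarith [hr.2]) _)
          (Real.rpow_nonneg (by linarith [mem_Ioi.1 h]) _)
      · rw [indicator_of_notMem h]
  have hswap := integral_integral_swap hFint
  have hleft : ∫ r in Ioc a t, ∫ s in Ioc a t, F r s = rlConv p a (rlConv q a g) t := by
    rw [rlConv, intervalIntegral.integral_of_le hat]
    refine setIntegral_congr_fun measurableSet_Ioc fun r hr => ?_
    have : ∀ s, F r s = (t - r) ^ (p - 1) *
        (Iio r).indicator (fun s => (r - s) ^ (q - 1) * g s) s := by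
      intro s
      by_cases h : s < r
      · simp [hF, h]
      · simp [hF, h]
    have hset : Ioc a t ∩ Iio r = Ioo a r := by
      ext s
      simp only [mem_inter_iff, mem_Ioc, mem_Iio, mem_Ioo]
      constructor
      · rintro ⟨⟨h, _⟩, h'⟩; exact ⟨h, h'⟩
      · rintro ⟨h, h'⟩; exact ⟨⟨h, (h'.trans_le hr.2).le⟩, h'⟩
    simp only [this]
    rw [integral_const_mul, integral_indicator measurableSet_Iio,
      Measure.restrict_restrict measurableSet_Iio, inter_comm, hset, rlConv,
      intervalIntegral.integral_of_le hr.1.le, integral_Ioc_eq_integral_Ioo]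
  have hright : ∫ s in Ioc a t, ∫ r in Ioc a t, F r s = beta p q * rlConv (p + q) a g t := by
    rw [rlConv, intervalIntegral.integral_of_le hat, ← integral_const_mul]
    refine integral_congr_ae ?_
    filter_upwards [hae] with s hs
    simp only [hFeq s hs]
    rw [integral_mul_const, hval s hs]
    ring
  rw [← hleft, hswap, hright]

/-- Rescaled form of the Riemann–Liouville integral on the unit interval. -/
theorem rlConv_eq_rpow_mul {p a t : ℝ} (hp : 0 < p) (hat : a ≤ t) (g : ℝ → ℝ) :
    rlConv p a g t = (t - a) ^ p * ∫ y in (0 : ℝ)..1, (1 - y) ^ (p - 1) * g (a + (t - a) * y) := by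
  rcases hat.eq_or_lt with rfl | h
  · simp [rlConv, Real.zero_rpow hp.ne']
  have hpos : 0 < t - a := sub_pos.2 h
  have h1 := intervalIntegral.integral_comp_add_mul (a := 0) (b := 1)
    (fun r => (t - r) ^ (p - 1) * g r) hpos.ne' a
  simp only [mul_zero, add_zero, mul_one, add_sub_cancel, smul_eq_mul] at h1
  rw [rlConv]
  have h2 : ∫ r in a..t, (t - r) ^ (p - 1) * g r = (t - a) * ∫ x in (0 : ℝ)..1,
      (t - (a + (t - a) * x)) ^ (p - 1) * g (a + (t - a) * x) := by
    rw [h1, ← mul_assoc, mul_inv_cancel₀ hpos.ne', one_mul]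
  rw [h2, ← intervalIntegral.integral_const_mul, ← intervalIntegral.integral_const_mul]
  refine intervalIntegral.integral_congr fun y hy => ?_
  rw [uIcc_of_le zero_le_one] at hy
  rw [show t - (a + (t - a) * y) = (t - a) * (1 - y) by ring,
    Real.mul_rpow hpos.le (by linarith [hy.2]), Real.rpow_sub_one hpos.ne']
  field_simp

theorem continuousOn_rlConv {p a : ℝ} (hp : 0 < p) {g : ℝ → ℝ} (hg : Continuous g) :
    ContinuousOn (rlConv p a g) (Ici a) := by
  have hc : Continuous fun t => ∫ y in (0 : ℝ)..1, (1 - y) ^ (p - 1) * g (a + (t - a) * y) := by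
    rw [continuous_iff_continuousAt]
    intro t₀
    obtain ⟨C, hC⟩ := (isCompact_Icc (a := a - (|t₀ - a| + 1))
      (b := a + (|t₀ - a| + 1))).exists_bound_of_continuousOn hg.continuousOn
    refine intervalIntegral.continuousAt_of_dominated_interval
      (bound := fun y => (1 - y) ^ (p - 1) * C) ?_ ?_ ?_ ?_
    · refine Eventually.of_forall fun t => ?_
      refine Measurable.aestronglyMeasurable ?_
      exact Measurable.mul (by fun_prop) (hg.measurable.comp (by fun_prop))
    · filter_upwards [Metric.ball_mem_nhds t₀ one_pos] with t ht
      refine Eventually.of_forall fun y hy => ?_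
      rw [uIoc_of_le zero_le_one] at hy
      rw [norm_mul, Real.norm_of_nonneg (Real.rpow_nonneg (by linarith [hy.2]) _)]
      refine mul_le_mul_of_nonneg_left (hC _ ?_) (Real.rpow_nonneg (by linarith [hy.2]) _)
      have h1 : |(t - a) * y| ≤ |t₀ - a| + 1 := by
        rw [abs_mul, abs_of_pos hy.1]
        have h2 : |t - a| ≤ |t₀ - a| + 1 := by
          rw [Metric.mem_ball, Real.dist_eq] at ht
          calc |t - a| = |(t - t₀) + (t₀ - a)| := by ring_nf
            _ ≤ |t - t₀| + |t₀ - a| := abs_add_le _ _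
            _ ≤ _ := by linarith
        nlinarith [abs_nonneg (t - a), hy.1, hy.2]
      have := abs_le.1 h1
      constructor <;> linarith [this.1, this.2]
    · exact (intervalIntegrable_sub_rpow hp 1 0 1).mul_const C
    · exact Eventually.of_forall fun y _ => by fun_prop
  refine ContinuousOn.congr
    (f := fun t => (t - a) ^ p * ∫ y in (0 : ℝ)..1, (1 - y) ^ (p - 1) * g (a + (t - a) * y)) ?_
    (fun t ht => rlConv_eq_rpow_mul hp ht g)
  exact ((Real.continuous_rpow_const hp.le).comp (by fun_prop)).continuousOn.mul hc.continuousOn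

end RiemannLiouville

section Touching

open Filter Topology ProbabilityTheory

theorem convexOn_rpow_neg {β : ℝ} (hβ : 0 ≤ β) : ConvexOn ℝ (Ioi 0) fun x : ℝ => x ^ (-β) := by
  refine ⟨convex_Ioi 0, fun x hx y hy a b ha hb hab => ?_⟩
  have hx' : 0 < x := hx
  have hy' : 0 < y := hy
  have hxy : 0 < a • x + b • y := (convex_Ioi (0 : ℝ)) hx hy ha hb hab
  have hlog := strictConcaveOn_log_Ioi.concaveOn.2 hx hy ha hb hab
  have hexp := convexOn_exp.2 (mem_univ (Real.log x * -β)) (mem_univ (Real.log y * -β)) ha hb hab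
  simp only [smul_eq_mul] at *
  rw [Real.rpow_def_of_pos hxy, Real.rpow_def_of_pos hx', Real.rpow_def_of_pos hy']
  refine le_trans (Real.exp_le_exp.2 ?_) hexp
  nlinarith

theorem rpow_neg_sub_le {β b s t : ℝ} (hβ : 0 ≤ β) (hb : 0 < b) (hbs : b ≤ s) (hst : s ≤ t) :
    s ^ (-β) - t ^ (-β) ≤ β * b ^ (-β - 1) * (t - s) := by
  rcases hst.eq_or_lt with rfl | hst
  · simp
  have hs : 0 < s := hb.trans_le hbs
  have h := (convexOn_rpow_neg hβ).le_slope_of_hasDerivAt (x := s) (y := t) hs (hs.trans hst) hst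
    (Real.hasDerivAt_rpow_const (Or.inl hs.ne'))
  rw [slope_def_field, le_div_iff₀ (sub_pos.2 hst)] at h
  have h2 : s ^ (-β - 1) ≤ b ^ (-β - 1) :=
    Real.rpow_le_rpow_of_nonpos hb hbs (by linarith)
  have h3 : β * s ^ (-β - 1) * (t - s) ≤ β * b ^ (-β - 1) * (t - s) := by
    have := sub_pos.2 hst
    gcongr
  linarith

/-- A concave function has antitone derivative. -/
theorem ConcaveOn.hasDerivAt_antitone {S : Set ℝ} {f : ℝ → ℝ} {s t fs ft : ℝ}
    (hf : ConcaveOn ℝ S f) (hs : s ∈ S) (ht : t ∈ S) (hst : s ≤ t)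
    (hfs : HasDerivAt f fs s) (hft : HasDerivAt f ft t) : ft ≤ fs := by
  rcases hst.eq_or_lt with rfl | hst
  · exact (hft.unique hfs).le
  exact (hf.le_slope_of_hasDerivAt hs ht hst hft).trans (hf.slope_le_of_hasDerivAt hs ht hst hfs)

/-- The history part of an Abel integral, as a function of the final time, is concave. -/
theorem concaveOn_history {β a c : ℝ} (hβ : 0 < β) (hβ1 : β < 1) (ha : 0 ≤ a) (hc : 0 ≤ c)
    {k : ℝ → ℝ} (hk : ContinuousOn k (Icc 0 a)) (hk0 : ∀ r ∈ Icc 0 a, 0 ≤ k r) :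
    ConcaveOn ℝ (Ioi a)
      fun t => c * t ^ (1 - β) - ∫ r in (0 : ℝ)..a, (t - r) ^ (1 - β - 1) * k r := by
  have hinteg : ∀ t, IntervalIntegrable (fun r => (t - r) ^ (1 - β - 1) * k r) volume 0 a :=
    fun t => intervalIntegrable_sub_rpow_mul (by linarith) (by rwa [uIcc_of_le ha])
  refine ConcaveOn.sub ?_ ⟨convex_Ioi a, fun x hx y hy p q hp hq hpq => ?_⟩
  · exact ((Real.concaveOn_rpow (by linarith) (by linarith)).smul hc).subset
      (fun x hx => ha.trans (le_of_lt hx)) (convex_Ioi a)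
  · have hxy : a < p • x + q • y := (convex_Ioi a) hx hy hp hq hpq
    simp only [smul_eq_mul] at *
    rw [← intervalIntegral.integral_const_mul, ← intervalIntegral.integral_const_mul,
      ← intervalIntegral.integral_add ((hinteg x).const_mul p) ((hinteg y).const_mul q)]
    refine intervalIntegral.integral_mono_on ha (hinteg _)
      (((hinteg x).const_mul p).add ((hinteg y).const_mul q)) fun r hr => ?_
    have h := (convexOn_rpow_neg hβ.le).2 (x := x - r) (y := y - r)
      (sub_pos.2 (hr.2.trans_lt hx)) (sub_pos.2 (hr.2.trans_lt hy)) hp hq hpq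
    simp only [smul_eq_mul] at h
    rw [show p * (x - r) + q * (y - r) = p * x + q * y - (p + q) * r by ring, hpq, one_mul] at h
    rw [show 1 - β - 1 = -β by ring]
    nlinarith [mul_le_mul_of_nonneg_right h (hk0 r hr)]

variable {β a b t₁ n : ℝ} {f φ : ℝ → ℝ}

/-- Decomposition of `∫ f` through the Abel inversion, separating the history before `a`. -/
theorem integral_rlConv_eq (hβ : 0 < β) (hβ1 : β < 1) (ha : 0 ≤ a) (hf : Continuous f)
    (hφ : Continuous φ) (n : ℝ) {t : ℝ} (hat : a ≤ t)
    (hN : ∀ r ∈ Icc a t, rlConv β 0 f r = rlConv β 0 f a + ∫ u in a..r, φ u) :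
    (rlConv β 0 f a + n) / (1 - β) * t ^ (1 - β)
      - ∫ r in (0 : ℝ)..a, (t - r) ^ (1 - β - 1) * (rlConv β 0 f a + n - rlConv β 0 f r)
    = beta (1 - β) β * (∫ r in (0 : ℝ)..t, f r) + n * ((t - a) ^ (1 - β) / (1 - β))
      - ∫ r in a..t, rlConv (1 - β) a φ r := by
  have h1β : 0 < 1 - β := by linarith
  have hNc := continuousOn_rlConv (a := 0) hβ hf
  have h1 := rlConv_rlConv h1β hβ (ha.trans hat) hf
  rw [sub_add_cancel, rlConv_one] at h1
  have hφ1 : Continuous (rlConv 1 a φ) := by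
    simp only [funext (rlConv_one a φ)]
    exact intervalIntegral.continuous_primitive (fun _ _ => hφ.intervalIntegrable _ _) a
  have h2 : rlConv (1 - β) a (rlConv 1 a φ) t = ∫ r in a..t, rlConv (1 - β) a φ r := by
    rw [← rlConv_one, rlConv_rlConv h1β one_pos hat hφ, rlConv_rlConv one_pos h1β hat hφ,
      beta_comm, add_comm]
  have hI1 : IntervalIntegrable (fun r => (t - r) ^ (1 - β - 1) * rlConv β 0 f r) volume 0 a :=
    intervalIntegrable_sub_rpow_mul h1β
      (hNc.mono (by rw [uIcc_of_le ha]; exact Icc_subset_Ici_self))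
  have hI2 : IntervalIntegrable (fun r => (t - r) ^ (1 - β - 1) * rlConv β 0 f r) volume a t :=
    intervalIntegrable_sub_rpow_mul h1β
      (hNc.mono (by rw [uIcc_of_le hat]; exact fun x hx => ha.trans hx.1))
  have h3 : rlConv (1 - β) 0 (rlConv β 0 f) t
      = (∫ r in (0 : ℝ)..a, (t - r) ^ (1 - β - 1) * rlConv β 0 f r)
        + rlConv (1 - β) a (rlConv β 0 f) t :=
    (intervalIntegral.integral_add_adjacent_intervals hI1 hI2).symm
  have h4 : rlConv (1 - β) a (rlConv β 0 f) t
      = rlConv β 0 f a * ((t - a) ^ (1 - β) / (1 - β)) + ∫ r in a..t, rlConv (1 - β) a φ r := by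
    rw [← h2, ← rlConv_const h1β, ← rlConv_add h1β continuous_const hφ1]
    exact rlConv_congr hat fun r hr => by rw [hN r hr, rlConv_one]
  have h5 : ∫ r in (0 : ℝ)..a, (t - r) ^ (1 - β - 1) * (rlConv β 0 f a + n - rlConv β 0 f r)
      = (t ^ (1 - β) - (t - a) ^ (1 - β)) / (1 - β) * (rlConv β 0 f a + n)
        - ∫ r in (0 : ℝ)..a, (t - r) ^ (1 - β - 1) * rlConv β 0 f r := by
    have := intervalIntegral.integral_sub
      ((intervalIntegrable_sub_rpow h1β t 0 a).mul_const (rlConv β 0 f a + n)) hI1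
    rw [intervalIntegral.integral_mul_const, integral_sub_rpow h1β, sub_zero] at this
    rw [← this]
    simp only [mul_sub]
  rw [h5]
  rw [h4] at h3
  rw [h3] at h1
  rw [← h1]
  ring

/-- Lower bound for the increments of the Abel transform of the derivative `φ` of `rlConv β 0 f`. -/
theorem rlConv_increment (hβ : 0 < β) (hβ1 : β < 1) (ha : 0 ≤ a) (hf : Continuous f)
    (hφ : Continuous φ) (hn : ∀ r ∈ Icc 0 a, rlConv β 0 f r ≤ rlConv β 0 f a + n)
    (hN : ∀ r ∈ Icc a t₁, rlConv β 0 f r = rlConv β 0 f a + ∫ u in a..r, φ u)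
    {s t : ℝ} (has : a < s) (hst : s ≤ t) (ht : t < t₁) :
    beta (1 - β) β * (f t - f s) + n * ((t - a) ^ (-β) - (s - a) ^ (-β))
      ≤ rlConv (1 - β) a φ t - rlConv (1 - β) a φ s := by
  have h1β : 0 < 1 - β := by linarith
  have hN0 : 0 ≤ rlConv β 0 f a + n := by
    simpa [rlConv] using hn 0 ⟨le_rfl, ha⟩
  have hconc := concaveOn_history (c := (rlConv β 0 f a + n) / (1 - β)) hβ hβ1 ha
    (div_nonneg hN0 h1β.le) (k := fun r => rlConv β 0 f a + n - rlConv β 0 f r)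
    (continuousOn_const.sub ((continuousOn_rlConv (a := 0) hβ hf).mono Icc_subset_Ici_self))
    (fun r hr => sub_nonneg.2 (hn r hr))
  have hJ := continuousOn_rlConv (a := a) h1β hφ
  have hder : ∀ x ∈ Ioo a t₁, HasDerivAt (fun t => (rlConv β 0 f a + n) / (1 - β) * t ^ (1 - β)
      - ∫ r in (0 : ℝ)..a, (t - r) ^ (1 - β - 1) * (rlConv β 0 f a + n - rlConv β 0 f r))
      (beta (1 - β) β * f x + n * (x - a) ^ (-β) - rlConv (1 - β) a φ x) x := by
    intro x hx
    have hxa : x - a ≠ 0 := (sub_pos.2 hx.1).ne'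
    have d1 : HasDerivAt (fun t => ∫ r in (0 : ℝ)..t, f r) (f x) x :=
      (hf.integral_hasStrictDerivAt 0 x).hasDerivAt
    have d2 : HasDerivAt (fun t => (t - a) ^ (1 - β) / (1 - β)) ((x - a) ^ (-β)) x := by
      refine ((((hasDerivAt_id' x).sub_const a).rpow_const (p := 1 - β)
        (Or.inl hxa)).div_const (1 - β)).congr_deriv ?_
      rw [show 1 - β - 1 = -β by ring]
      field_simp
    have d3 : HasDerivAt (fun t => ∫ r in a..t, rlConv (1 - β) a φ r)
        (rlConv (1 - β) a φ x) x := by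
      refine intervalIntegral.integral_hasDerivAt_right ?_ ?_ (hJ.continuousAt (Ici_mem_nhds hx.1))
      · exact (hJ.mono (by rw [uIcc_of_le hx.1.le]; exact Icc_subset_Ici_self)).intervalIntegrable
      · exact (hJ.mono Ioi_subset_Ici_self).stronglyMeasurableAtFilter isOpen_Ioi x hx.1
    refine (((d1.const_mul (beta (1 - β) β)).add (d2.const_mul n)).sub d3).congr_of_eventuallyEq ?_
    filter_upwards [isOpen_Ioo.mem_nhds hx] with y hy
    exact integral_rlConv_eq hβ hβ1 ha hf hφ n hy.1.le
      fun r hr => hN r ⟨hr.1, hr.2.trans hy.2.le⟩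
  have := hconc.hasDerivAt_antitone has (has.trans_le hst) hst
    (hder s ⟨has, hst.trans_lt ht⟩) (hder t ⟨has.trans_le hst, ht⟩)
  linarith

/-- Increments of the Abel transform of a nonnegative function that are bounded below force its
final values to be positive. -/
theorem integral_tail_lower_bound {c : ℝ} (hβ : 0 < β) (hβ1 : β < 1) (hφ : Continuous φ)
    (hφ0 : ∀ r ∈ Icc b t₁, 0 ≤ φ r)
    (hJ : ∀ s t, b < s → s ≤ t → t < t₁ →
      c * (t - s) ≤ rlConv (1 - β) b φ t - rlConv (1 - β) b φ s)
    {h : ℝ} (hh : 0 ≤ h) (hhb : h ≤ t₁ - b) :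
    c * h * ((t₁ - b - h) ^ β / β) ≤ beta β (1 - β) * ∫ r in (t₁ - h)..t₁, φ r := by
  have h1β : 0 < 1 - β := by linarith
  have hb : b ≤ t₁ := by linarith
  set J := rlConv (1 - β) b φ with hJdef
  have hJc : ContinuousOn J (Ici b) := continuousOn_rlConv h1β hφ
  have hrep : ∀ t, b ≤ t → ∫ u in (0 : ℝ)..(t - b), u ^ (β - 1) * J (t - u)
      = beta β (1 - β) * ∫ r in b..t, φ r := by
    intro t ht
    have := rlConv_rlConv hβ h1β ht hφ
    rw [add_sub_cancel, rlConv_one] at this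
    rw [← this, rlConv]
    have h2 := intervalIntegral.integral_comp_sub_left (a := 0) (b := t - b)
      (fun r => (t - r) ^ (β - 1) * J r) t
    simp only [sub_sub_cancel, sub_zero] at h2
    exact h2
  have hinteg : ∀ t, b ≤ t → ∀ x y, 0 ≤ x → x ≤ y → y ≤ t - b →
      IntervalIntegrable (fun u => u ^ (β - 1) * J (t - u)) volume x y := by
    intro t ht x y hx hxy hy
    refine (intervalIntegral.intervalIntegrable_rpow' (by linarith)).mul_continuousOn ?_
    refine hJc.comp (by fun_prop) fun u hu => ?_
    rw [uIcc_of_le hxy] at hu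
    simp only [mem_Ici]
    linarith [hu.2]
  have hsub : t₁ - h - b = t₁ - b - h := by ring
  have e1 := hrep t₁ hb
  have e2 := hrep (t₁ - h) (by linarith)
  rw [hsub] at e2
  have i1 := hinteg t₁ hb 0 (t₁ - b - h) le_rfl (by linarith) (by linarith)
  have i2 := hinteg t₁ hb (t₁ - b - h) (t₁ - b) (by linarith) (by linarith) le_rfl
  have i3 := hinteg (t₁ - h) (by linarith) 0 (t₁ - b - h) le_rfl (by linarith) (by linarith)
  rw [← intervalIntegral.integral_add_adjacent_intervals i1 i2] at e1
  have e3 : (∫ r in b..t₁, φ r) - ∫ r in b..(t₁ - h), φ r = ∫ r in (t₁ - h)..t₁, φ r :=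
    intervalIntegral.integral_interval_sub_left (hφ.intervalIntegrable _ _)
      (hφ.intervalIntegrable _ _)
  rw [← e3, mul_sub, ← e1, ← e2]
  have hpos : 0 ≤ ∫ u in (t₁ - b - h)..(t₁ - b), u ^ (β - 1) * J (t₁ - u) := by
    refine intervalIntegral.integral_nonneg (by linarith) fun u hu => ?_
    have hu0 : 0 ≤ u := le_trans (by linarith) hu.1
    refine mul_nonneg (Real.rpow_nonneg hu0 _) ?_
    refine intervalIntegral.integral_nonneg (by linarith [hu.2]) fun r hr => ?_
    exact mul_nonneg (Real.rpow_nonneg (by linarith [hr.2]) _)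
      (hφ0 r ⟨hr.1, by linarith [hr.2]⟩)
  have hmain : c * h * ((t₁ - b - h) ^ β / β)
      ≤ ∫ u in (0 : ℝ)..(t₁ - b - h),
          (u ^ (β - 1) * J (t₁ - u) - u ^ (β - 1) * J (t₁ - h - u)) := by
    have hI : ∫ u in (0 : ℝ)..(t₁ - b - h), u ^ (β - 1) = (t₁ - b - h) ^ β / β := by
      rw [integral_rpow (Or.inl (by linarith)), sub_add_cancel, Real.zero_rpow hβ.ne', sub_zero]
    rw [← hI, ← intervalIntegral.integral_const_mul]
    refine intervalIntegral.integral_mono_on_of_le_Ioo (by linarith)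
      ((intervalIntegral.intervalIntegrable_rpow' (by linarith)).const_mul _) (i1.sub i3)
      fun u hu => ?_
    have := hJ (t₁ - h - u) (t₁ - u) (by linarith [hu.2]) (by linarith) (by linarith [hu.1])
    rw [← mul_sub, mul_comm]
    refine mul_le_mul_of_nonneg_left ?_ (Real.rpow_nonneg hu.1.le _)
    linarith
  rw [intervalIntegral.integral_sub i1 i3] at hmain
  linarith

/-- Touching lemma: if the Abel integral of `f` has nonnegative derivative `φ` on `[a, t₁]`,
vanishing at `t₁`, then `f` cannot increase too fast before `t₁`. -/
theorem beta_mul_increment_le {σ : ℝ} (hβ : 0 < β) (hβ1 : β < 1) (ha : 0 ≤ a) (hab : a < b)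
    (hbt : b < t₁) (hf : Continuous f) (hφ : Continuous φ)
    (hder : ∀ r ∈ Ioo a t₁, HasDerivAt (rlConv β 0 f) (φ r) r)
    (hφ0 : ∀ r ∈ Icc a t₁, 0 ≤ φ r) (hφ1 : φ t₁ = 0) (hn0 : 0 ≤ n)
    (hn : ∀ r ∈ Icc 0 a, rlConv β 0 f r ≤ rlConv β 0 f a + n)
    (hσ : ∀ s t, b ≤ s → s ≤ t → t ≤ t₁ → σ * (t - s) ≤ f t - f s) :
    beta (1 - β) β * σ ≤ n * (β * (b - a) ^ (-β - 1)) := by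
  have h1β : 0 < 1 - β := by linarith
  have hNc := continuousOn_rlConv (a := 0) hβ hf
  have hN : ∀ r ∈ Icc a t₁, rlConv β 0 f r = rlConv β 0 f a + ∫ u in a..r, φ u := by
    intro r hr
    rw [intervalIntegral.integral_eq_sub_of_hasDerivAt_of_le hr.1
      (hNc.mono fun x hx => ha.trans hx.1)
      (fun x hx => hder x ⟨hx.1, hx.2.trans_le hr.2⟩) (hφ.intervalIntegrable _ _)]
    ring
  have hJb : ∀ s t, b < s → s ≤ t → t < t₁ →
      (beta (1 - β) β * σ - n * (β * (b - a) ^ (-β - 1))) * (t - s)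
        ≤ rlConv (1 - β) b φ t - rlConv (1 - β) b φ s := by
    intro s t hs hst ht
    have h1 := rlConv_increment hβ hβ1 ha hf hφ hn hN (hab.trans hs) hst ht
    have h2 := hσ s t hs.le hst ht.le
    have h3 := rpow_neg_sub_le hβ.le (sub_pos.2 hab) (s := s - a) (t := t - a) (by linarith)
      (by linarith)
    have hi : ∀ x y z, IntervalIntegrable (fun r => (z - r) ^ (1 - β - 1) * φ r) volume x y :=
      fun x y z => intervalIntegrable_sub_rpow_mul h1β hφ.continuousOn
    have h4 : ∀ z, rlConv (1 - β) a φ z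
        = (∫ r in a..b, (z - r) ^ (1 - β - 1) * φ r) + rlConv (1 - β) b φ z := fun z =>
      (intervalIntegral.integral_add_adjacent_intervals (hi a b z) (hi b z z)).symm
    have h5 : ∫ r in a..b, (t - r) ^ (1 - β - 1) * φ r ≤ ∫ r in a..b, (s - r) ^ (1 - β - 1) * φ r :=
      intervalIntegral.integral_mono_on hab.le (hi _ _ _) (hi _ _ _) fun r hr =>
        mul_le_mul_of_nonneg_right
          (Real.rpow_le_rpow_of_nonpos (by linarith [hr.2]) (by linarith) (by linarith))
          (hφ0 r ⟨hr.1, hr.2.trans hbt.le⟩)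
    rw [h4 t, h4 s] at h1
    have h6 := mul_le_mul_of_nonneg_left h2 (beta_pos h1β hβ).le
    have h7 := mul_le_mul_of_nonneg_left h3 hn0
    have h8 : t - a - (s - a) = t - s := by ring
    rw [h8] at h7
    nlinarith
  by_contra! hlt
  set c := beta (1 - β) β * σ - n * (β * (b - a) ^ (-β - 1)) with hc
  have hc0 : 0 < c := sub_pos.2 hlt
  have hB := beta_pos hβ h1β
  set l := t₁ - b with hl
  have hl0 : 0 < l := sub_pos.2 hbt
  have hq : 0 < c * ((l / 2) ^ β / β) / (2 * beta β (1 - β)) := by positivity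
  obtain ⟨δ, hδ, hδφ⟩ := Metric.continuousAt_iff.1 (hφ.continuousAt (x := t₁)) _ hq
  set h := min (l / 2) (δ / 2) with hh
  have hh0 : 0 < h := by positivity
  have hhl : h ≤ l / 2 := min_le_left _ _
  have key := integral_tail_lower_bound hβ hβ1 hφ (fun r hr => hφ0 r ⟨hab.le.trans hr.1, hr.2⟩)
    hJb hh0.le (by linarith)
  have hup : ∫ r in (t₁ - h)..t₁, φ r
      ≤ ∫ _r in (t₁ - h)..t₁, c * ((l / 2) ^ β / β) / (2 * beta β (1 - β)) := by
    refine intervalIntegral.integral_mono_on (by linarith) (hφ.intervalIntegrable _ _)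
      intervalIntegrable_const fun r hr => ?_
    have hd := hδφ (x := r) (by
      rw [Real.dist_eq, abs_lt]
      have := min_le_right (l / 2) (δ / 2)
      constructor <;> linarith [hr.1, hr.2])
    rw [Real.dist_eq, hφ1, sub_zero] at hd
    exact (le_abs_self _).trans hd.le
  rw [intervalIntegral.integral_const, sub_sub_cancel, smul_eq_mul] at hup
  have hlow : (l / 2) ^ β ≤ (l - h) ^ β :=
    Real.rpow_le_rpow (by positivity) (by linarith) hβ.le
  have h1 : c * h * ((l / 2) ^ β / β) ≤ c * h * ((l - h) ^ β / β) := by gcongr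
  have h2 := mul_le_mul_of_nonneg_left hup hB.le
  have h3 : beta β (1 - β) * (h * (c * ((l / 2) ^ β / β) / (2 * beta β (1 - β))))
      = c * h * ((l / 2) ^ β / β) / 2 := by
    field_simp
  have h4 : 0 < c * h * ((l / 2) ^ β / β) := by positivity
  linarith

/-- Infinitesimal form of the touching lemma. -/
theorem beta_mul_deriv_le {f' : ℝ → ℝ} (hβ : 0 < β) (hβ1 : β < 1) (ha : 0 ≤ a) (hat : a < t₁)
    (hf : Continuous f) (hf' : ∀ r ∈ Ioc a t₁, HasDerivAt f (f' r) r)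
    (hf'c : ContinuousWithinAt f' (Iic t₁) t₁)
    (hφ : ContinuousOn φ (Icc a t₁))
    (hder : ∀ r ∈ Ioo a t₁, HasDerivAt (rlConv β 0 f) (φ r) r)
    (hφ0 : ∀ r ∈ Icc a t₁, 0 ≤ φ r) (hφ1 : φ t₁ = 0) (hn0 : 0 ≤ n)
    (hn : ∀ r ∈ Icc 0 a, rlConv β 0 f r ≤ rlConv β 0 f a + n) :
    beta (1 - β) β * f' t₁ ≤ n * (β * ((t₁ - a) / 2) ^ (-β - 1)) := by
  have hB := beta_pos (sub_pos.2 hβ1) hβ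
  suffices H : ∀ σ < f' t₁, beta (1 - β) β * σ ≤ n * (β * ((t₁ - a) / 2) ^ (-β - 1)) by
    refine le_of_tendsto (f := fun σ => beta (1 - β) β * σ) (x := 𝓝[<] (f' t₁)) ?_
      (eventually_nhdsWithin_of_forall H)
    exact (Continuous.tendsto (by fun_prop) _).mono_left nhdsWithin_le_nhds
  intro σ hσ
  obtain ⟨l, hl, hlσ⟩ := (mem_nhdsLE_iff_exists_Ioc_subset).1 (hf'c (Ioi_mem_nhds hσ))
  set b := max ((l + t₁) / 2) ((a + t₁) / 2) with hb
  have hlt : l < t₁ := hl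
  have hb1 : (a + t₁) / 2 ≤ b := le_max_right _ _
  have hb2 : (l + t₁) / 2 ≤ b := le_max_left _ _
  have hbt : b < t₁ := max_lt (by linarith) (by linarith)
  have key := beta_mul_increment_le (σ := σ) (b := b)
    (φ := IccExtend hat.le ((Icc a t₁).domRestrict φ))
    hβ hβ1 ha (by linarith) hbt hf (hφ.domRestrict.Icc_extend') ?_ ?_ ?_ hn0 hn ?_
  · refine key.trans ?_
    have : (b - a) ^ (-β - 1) ≤ ((t₁ - a) / 2) ^ (-β - 1) :=
      Real.rpow_le_rpow_of_nonpos (by linarith) (by linarith) (by linarith)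
    gcongr
  · intro r hr
    rw [IccExtend_of_mem _ _ (Ioo_subset_Icc_self hr)]
    exact hder r hr
  · intro r hr
    rw [IccExtend_of_mem _ _ hr]
    exact hφ0 r hr
  · rw [IccExtend_of_mem _ _ (right_mem_Icc.2 hat.le)]
    exact hφ1
  · intro s t hs hst ht
    refine Convex.mul_sub_le_image_sub_of_le_deriv (convex_Icc b t₁) (f := f) hf.continuousOn
      ?_ ?_ s ⟨hs, hst.trans ht⟩ t ⟨hs.trans hst, ht⟩ hst
    · intro x hx
      rw [interior_Icc] at hx
      exact (hf' x ⟨by linarith [hx.1], hx.2.le⟩).differentiableAt.differentiableWithinAt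
    · intro x hx
      rw [interior_Icc] at hx
      rw [(hf' x ⟨by linarith [hx.1], hx.2.le⟩).deriv]
      exact le_of_lt (hlσ ⟨by linarith [hx.1], hx.2.le⟩)

end Touching

section MinimumPrinciple

open Filter Topology ProbabilityTheory

/-- Data of a nonlocal minimum principle: `ν` is the time derivative of the Abel integral of `m`,
and the time derivative `m'` of `m` is controlled from below at negative spatial minima of `ν`. -/
structure AbelMinimumPrinciple {X : Type*} [TopologicalSpace X] (β T K : ℝ)
    (m m' ν : ℝ → X → ℝ) : Prop where
  cont : Continuous fun p : ℝ × X => m p.1 p.2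
  hasDerivAt : ∀ x, ∀ t ∈ Ioo 0 T, HasDerivAt (fun s => m s x) (m' t x) t
  continuousOn_deriv : ∀ x, ContinuousOn (fun t => m' t x) (Ioo 0 T)
  hasDerivAt_abel : ∀ x, ∀ t ∈ Ioo 0 T, HasDerivAt (rlConv β 0 fun s => m s x) (ν t x) t
  continuousOn_abel : ContinuousOn (fun p : ℝ × X => ν p.1 p.2) (Ioo 0 T ×ˢ univ)
  lower_bound : ∀ t ∈ Ioo 0 T, ∀ x, (∀ y, ν t x ≤ ν t y) → ν t x < 0 → K * ν t x ≤ m' t x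
  init_nonneg : ∀ x, 0 ≤ m 0 x

namespace AbelMinimumPrinciple

variable {X : Type*} [TopologicalSpace X] {β T K : ℝ} {m m' ν : ℝ → X → ℝ}

theorem continuous_time (h : AbelMinimumPrinciple β T K m m' ν) (x : X) :
    Continuous fun s => m s x :=
  h.cont.comp (by fun_prop : Continuous fun s : ℝ => (s, x))

theorem continuousOn_abel_time (h : AbelMinimumPrinciple β T K m m' ν) (x : X) :
    ContinuousOn (fun t => ν t x) (Ioo 0 T) :=
  h.continuousOn_abel.comp (by fun_prop : ContinuousOn (fun t : ℝ => (t, x)) (Ioo 0 T))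
    fun _ ht => ⟨ht, mem_univ _⟩

/-- Contact with a barrier `-A * w`, where `w` is the derivative of the Abel integral of `g`. -/
theorem contact (h : AbelMinimumPrinciple β T K m m' ν) (hβ : 0 < β) (hβ1 : β < 1)
    {a t₁ A n : ℝ} {x : X} {g g' w : ℝ → ℝ} (ha : 0 < a) (hat : a < t₁) (ht : t₁ < T)
    (hg : Continuous g) (hg' : ∀ r ∈ Ioc a t₁, HasDerivAt g (g' r) r)
    (hg'c : ContinuousWithinAt g' (Iic t₁) t₁) (hw : ContinuousOn w (Icc a t₁))
    (hW : ∀ r ∈ Ioo a t₁, HasDerivAt (rlConv β 0 g) (w r) r) (hA : 0 < A) (hwt : 0 < w t₁)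
    (hmin : ∀ y, ν t₁ x ≤ ν t₁ y) (hbar : ∀ r ∈ Icc a t₁, -(A * w r) ≤ ν r x)
    (hcon : ν t₁ x = -(A * w t₁)) (hn0 : 0 ≤ n)
    (hn : ∀ r ∈ Icc 0 a, rlConv β 0 (fun s => m s x) r + A * rlConv β 0 g r
      ≤ rlConv β 0 (fun s => m s x) a + A * rlConv β 0 g a + n) :
    beta (1 - β) β * (A * (g' t₁ - K * w t₁)) ≤ n * (β * ((t₁ - a) / 2) ^ (-β - 1)) := by
  have hsub : Icc a t₁ ⊆ Ioo 0 T := fun r hr => ⟨ha.trans_le hr.1, hr.2.trans_lt ht⟩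
  have hmem : t₁ ∈ Ioo 0 T := hsub (right_mem_Icc.2 hat.le)
  have hm := h.continuous_time x
  have hadd : rlConv β 0 (fun s => m s x + A * g s)
      = fun t => rlConv β 0 (fun s => m s x) t + A * rlConv β 0 g t := by
    ext t
    rw [rlConv_add hβ hm (by fun_prop), rlConv_const_mul]
  have key := beta_mul_deriv_le (f := fun s => m s x + A * g s)
    (f' := fun s => m' s x + A * g' s) (φ := fun r => ν r x + A * w r) (n := n)
    hβ hβ1 ha.le hat (by fun_prop) ?_ ?_ ?_ ?_ ?_ ?_ hn0 ?_
  · refine le_trans ?_ key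
    have hlow := h.lower_bound t₁ hmem x hmin (by rw [hcon]; nlinarith)
    rw [hcon] at hlow
    refine mul_le_mul_of_nonneg_left ?_ (beta_pos (sub_pos.2 hβ1) hβ).le
    linarith
  · exact fun r hr => (h.hasDerivAt x r (hsub (Ioc_subset_Icc_self hr))).add
      ((hg' r hr).const_mul A)
  · exact ((h.continuousOn_deriv x).continuousAt (isOpen_Ioo.mem_nhds hmem)).continuousWithinAt.add
      (hg'c.const_mul A)
  · exact ((h.continuousOn_abel_time x).mono hsub).add (hw.const_mul A)
  · intro r hr
    rw [hadd]
    exact (h.hasDerivAt_abel x r (hsub (Ioo_subset_Icc_self hr))).add ((hW r hr).const_mul A)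
  · exact fun r hr => by linarith [hbar r hr]
  · simp only [hcon, neg_add_cancel]
  · rw [hadd]
    exact hn

theorem exists_step_length {κ C : ℝ} (hκ : 0 < κ) (hβ : 0 < β) (hκβ : κ < β) (K : ℝ) :
    ∃ τ > 0, ∀ y ∈ Ioc 0 τ,
      K * (y ^ (β - 1) + C * y ^ (β + κ - 1)) < κ * y ^ (κ - 1) := by
  have hc : ContinuousAt (fun y : ℝ => K * (y ^ (β - κ) + C * y ^ β)) 0 := by
    have h1 := Real.continuous_rpow_const (sub_pos.2 hκβ).le
    have h2 := Real.continuous_rpow_const hβ.le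
    fun_prop
  have hev : ∀ᶠ y in 𝓝 (0 : ℝ), K * (y ^ (β - κ) + C * y ^ β) < κ := by
    refine hc.eventually_lt continuousAt_const ?_
    simpa [Real.zero_rpow hβ.ne', Real.zero_rpow (sub_pos.2 hκβ).ne'] using hκ
  obtain ⟨δ, hδ, hδ'⟩ := Metric.eventually_nhds_iff.1 hev
  refine ⟨δ / 2, by positivity, fun y hy => ?_⟩
  have hy0 : 0 < y := hy.1
  have h1 := hδ' (y := y) (by rw [dist_zero_right, Real.norm_of_nonneg hy0.le]; linarith [hy.2])
  have h2 := mul_lt_mul_of_pos_right h1 (Real.rpow_pos_of_pos hy0 (κ - 1))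
  refine lt_of_eq_of_lt ?_ h2
  rw [show β - 1 = (β - κ) + (κ - 1) by ring, show β + κ - 1 = β + (κ - 1) by ring,
    Real.rpow_add hy0, Real.rpow_add hy0]
  ring

theorem continuous_max_sub_rpow {p : ℝ} (hp : 0 ≤ p) (b : ℝ) :
    Continuous fun r : ℝ => (max (r - b) 0) ^ p :=
  (Real.continuous_rpow_const hp).comp (by fun_prop)

theorem rlConv_one_add_max_rpow {κ b t : ℝ} (hβ : 0 < β) (hκ : 0 < κ) (hb : 0 ≤ b) (ht : 0 ≤ t) :
    rlConv β 0 (fun r => 1 + (max (r - b) 0) ^ κ) t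
      = t ^ β / β + beta β (κ + 1) * (max (t - b) 0) ^ (β + κ) := by
  rw [rlConv_add hβ continuous_const (continuous_max_sub_rpow hκ.le b), rlConv_const hβ,
    rlConv_max_rpow hβ hκ hb ht, sub_zero, one_mul]

theorem hasDerivAt_max_sub_rpow {p b r : ℝ} (hr : b < r) :
    HasDerivAt (fun r => (max (r - b) 0) ^ p) (p * (r - b) ^ (p - 1)) r := by
  have h0 : r - b ≠ 0 := (sub_pos.2 hr).ne'
  refine ((((hasDerivAt_id' r).sub_const b).rpow_const (p := p) (Or.inl h0)).congr_deriv
    (by ring)).congr_of_eventuallyEq ?_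
  filter_upwards [lt_mem_nhds hr] with y hy
  rw [max_eq_left (sub_pos.2 hy).le]

theorem hasDerivAt_rlConv_one_add_max_rpow {κ b r : ℝ} (hβ : 0 < β) (hκ : 0 < κ) (hb : 0 ≤ b)
    (hr : b < r) :
    HasDerivAt (rlConv β 0 (fun r => 1 + (max (r - b) 0) ^ κ))
      (r ^ (β - 1) + beta β (κ + 1) * (β + κ) * (r - b) ^ (β + κ - 1)) r := by
  have hr0 : 0 < r := hb.trans_lt hr
  have h1 := ((Real.hasDerivAt_rpow_const (p := β) (Or.inl hr0.ne')).div_const β).add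
    ((hasDerivAt_max_sub_rpow (p := β + κ) hr).const_mul (beta β (κ + 1)))
  refine (h1.congr_deriv ?_).congr_of_eventuallyEq ?_
  · field_simp
  · filter_upwards [lt_mem_nhds hr0] with y hy
    exact rlConv_one_add_max_rpow hβ hκ hb hy.le

/-- Nonnegativity propagates over a time step of fixed length. -/
theorem nonneg_step [CompactSpace X] (h : AbelMinimumPrinciple β T K m m' ν) (hβ : 0 < β)
    (hβ1 : β < 1) {κ τ b : ℝ} (hκ : 0 < κ)
    (hτ : ∀ y ∈ Ioc 0 τ, K * (y ^ (β - 1) + beta β (κ + 1) * (β + κ) * y ^ (β + κ - 1))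
      < κ * y ^ (κ - 1)) (hK : 0 ≤ K) (hb : 0 ≤ b)
    (hpos : ∀ t ∈ Ioo 0 b, t < T → ∀ x, 0 ≤ ν t x)
    (hnear : ∀ ε > 0, ∃ η > 0, ∀ t ∈ Ioo b (b + η), t < T → ∀ x, -(ε * t ^ (β - 1)) ≤ ν t x) :
    ∀ t ∈ Ioc b (b + τ), t < T → ∀ x, 0 ≤ ν t x := by
  intro t₂ ht₂ ht₂T x₂
  by_contra! hneg
  have hc : 0 < beta β (κ + 1) := beta_pos hβ (by linarith)
  set C := beta β (κ + 1) * (β + κ) with hC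
  have hC0 : 0 < C := by positivity
  set w : ℝ → ℝ := fun r => r ^ (β - 1) + C * (r - b) ^ (β + κ - 1) with hw
  have hwle : ∀ r, b < r → r ^ (β - 1) ≤ w r := fun r hr =>
    le_add_of_nonneg_right (mul_nonneg hC0.le (Real.rpow_nonneg (sub_pos.2 hr).le _))
  have hwpos : ∀ r, b < r → 0 < w r := fun r hr =>
    (Real.rpow_pos_of_pos (hb.trans_lt hr) _).trans_le (hwle r hr)
  have hwc : ContinuousOn w (Ioi b) := by
    refine ContinuousOn.add ?_ (continuousOn_const.mul ?_)
    · exact fun r hr => (Real.continuousAt_rpow_const _ _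
        (Or.inl (hb.trans_lt hr).ne')).continuousWithinAt
    · refine fun r hr => ContinuousAt.continuousWithinAt ?_
      exact ContinuousAt.rpow_const (by fun_prop) (Or.inl (sub_pos.2 hr).ne')
  have hε : 0 < -ν t₂ x₂ / (2 * w t₂) := div_pos (neg_pos.2 hneg) (by linarith [hwpos t₂ ht₂.1])
  obtain ⟨η, hη, hnear⟩ := hnear _ hε
  set b' := b + min η (t₂ - b) / 2 with hb'
  have hmin0 : 0 < min η (t₂ - b) := lt_min hη (sub_pos.2 ht₂.1)
  have hmin1 := min_le_left η (t₂ - b)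
  have hmin2 := min_le_right η (t₂ - b)
  have hbb' : b < b' := by linarith
  have hsub : Icc b' t₂ ×ˢ (univ : Set X) ⊆ Ioo 0 T ×ˢ univ := fun p hp =>
    ⟨⟨(hb.trans_lt hbb').trans_le hp.1.1, hp.1.2.trans_lt ht₂T⟩, mem_univ _⟩
  obtain ⟨⟨t₁, x₁⟩, ⟨ht₁, -⟩, hmin⟩ := (isCompact_Icc.prod isCompact_univ).exists_isMinOn
    (f := fun p : ℝ × X => ν p.1 p.2 / w p.1) (s := Icc b' t₂ ×ˢ univ)
    ⟨(t₂, x₂), ⟨by linarith, le_rfl⟩, mem_univ _⟩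
    ((h.continuousOn_abel.mono hsub).div
      (hwc.comp continuousOn_fst fun p hp => hbb'.trans_le hp.1.1)
      fun p hp => (hwpos _ (hbb'.trans_le hp.1.1)).ne')
  have hmin' : ∀ r ∈ Icc b' t₂, ∀ y, ν t₁ x₁ / w t₁ ≤ ν r y / w r := fun r hr y =>
    hmin (a := (r, y)) ⟨hr, mem_univ _⟩
  have hbt₁ : b < t₁ := hbb'.trans_le ht₁.1
  set A := -(ν t₁ x₁ / w t₁) with hA
  have hAε : -ν t₂ x₂ / (2 * w t₂) * 2 ≤ A := by
    have h1 := hmin' t₂ ⟨by linarith, le_rfl⟩ x₂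
    have h2 : -ν t₂ x₂ / (2 * w t₂) * 2 = -(ν t₂ x₂ / w t₂) := by
      have := (hwpos t₂ ht₂.1).ne'
      field_simp
    rw [h2]
    exact neg_le_neg h1
  have hA0 : 0 < A := lt_of_lt_of_le (by positivity) hAε
  have hbar : ∀ r ∈ Ioc b t₂, ∀ y, -(A * w r) ≤ ν r y := by
    intro r hr y
    rcases lt_or_ge r b' with hrb | hrb
    · refine le_trans (neg_le_neg ?_) (hnear r ⟨hr.1, by linarith⟩ (hr.2.trans_lt ht₂T) y)
      exact mul_le_mul (by linarith) (hwle r hr.1) (Real.rpow_nonneg (hb.trans hr.1.le) _) hA0.le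
    · have h1 := hmin' r ⟨hrb, hr.2⟩ y
      rw [le_div_iff₀ (hwpos r hr.1)] at h1
      rw [hA]
      linarith
  have hcon : ν t₁ x₁ = -(A * w t₁) := by
    rw [hA, neg_mul, neg_neg, div_mul_cancel₀ _ (hwpos t₁ hbt₁).ne']
  set g : ℝ → ℝ := fun r => 1 + (max (r - b) 0) ^ κ with hg
  have hgc : Continuous g :=
    continuous_const.add (continuous_max_sub_rpow hκ.le b)
  set N : ℝ → ℝ := fun r => rlConv β 0 (fun s => m s x₁) r + A * rlConv β 0 g r with hN
  have hNc : ContinuousOn N (Ici 0) := (continuousOn_rlConv hβ (h.continuous_time x₁)).add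
    ((continuousOn_rlConv hβ hgc).const_mul A)
  have hmono1 : MonotoneOn N (Icc 0 b) := by
    refine MonotoneOn.add ?_ ?_
    · refine monotoneOn_of_hasDerivWithinAt_nonneg (f' := fun r => ν r x₁) (convex_Icc 0 b)
        ((continuousOn_rlConv hβ (h.continuous_time x₁)).mono Icc_subset_Ici_self) ?_ ?_
      · intro r hr
        rw [interior_Icc] at hr
        exact (h.hasDerivAt_abel x₁ r ⟨hr.1, by linarith [hr.2, ht₂.1]⟩).hasDerivWithinAt
      · intro r hr
        rw [interior_Icc] at hr
        exact hpos r hr (by linarith [hr.2, ht₂.1]) x₁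
    · intro r hr s hs hrs
      refine mul_le_mul_of_nonneg_left ?_ hA0.le
      rw [hg, rlConv_one_add_max_rpow hβ hκ hb hr.1, rlConv_one_add_max_rpow hβ hκ hb hs.1]
      have h0 := hr.1
      have h1 : max (r - b) 0 ≤ max (s - b) 0 := max_le_max (by linarith) le_rfl
      have h2 : 0 ≤ max (r - b) 0 := le_max_right _ _
      gcongr
  set a := (b + t₁) / 2 with ha
  have hmono2 : MonotoneOn N (Icc b a) := by
    refine monotoneOn_of_hasDerivWithinAt_nonneg (f' := fun r => ν r x₁ + A * w r)
      (convex_Icc b a) (hNc.mono fun r hr => hb.trans hr.1) ?_ ?_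
    · intro r hr
      rw [interior_Icc] at hr
      exact ((h.hasDerivAt_abel x₁ r ⟨hb.trans_lt hr.1, by linarith [hr.2, ht₁.2]⟩).add
        ((hasDerivAt_rlConv_one_add_max_rpow hβ hκ hb hr.1).const_mul A)).hasDerivWithinAt
    · intro r hr
      rw [interior_Icc] at hr
      linarith [hbar r ⟨hr.1, by linarith [hr.2, ht₁.2]⟩ x₁]
  have hba : b ≤ a := by linarith
  have key := h.contact (g := g) (g' := fun r => κ * (r - b) ^ (κ - 1)) (w := w) (n := 0)
    (x := x₁) (a := a) (t₁ := t₁) (A := A) hβ hβ1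
    (by linarith) (by linarith) (by linarith [ht₁.2]) hgc ?_ ?_
    (hwc.mono fun r hr => lt_of_lt_of_le (by linarith) hr.1) ?_ hA0 (hwpos t₁ hbt₁) ?_ ?_ hcon
    le_rfl ?_
  · rw [zero_mul] at key
    have h1 : κ * (t₁ - b) ^ (κ - 1) - K * w t₁ ≤ 0 := by
      by_contra! h2
      exact absurd key (not_le.2 (mul_pos (beta_pos (sub_pos.2 hβ1) hβ) (mul_pos hA0 h2)))
    have h2 := hτ (t₁ - b) ⟨sub_pos.2 hbt₁, by linarith [ht₁.2, ht₂.2]⟩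
    have h3 : t₁ ^ (β - 1) ≤ (t₁ - b) ^ (β - 1) :=
      Real.rpow_le_rpow_of_nonpos (sub_pos.2 hbt₁) (by linarith) (by linarith)
    have h4 : K * w t₁ ≤ K * ((t₁ - b) ^ (β - 1) + C * (t₁ - b) ^ (β + κ - 1)) :=
      mul_le_mul_of_nonneg_left (add_le_add_left h3 _) hK
    linarith
  · exact fun r hr => (hasDerivAt_max_sub_rpow (by linarith [hr.1])).const_add 1
  · refine ContinuousAt.continuousWithinAt (continuousAt_const.mul ?_)
    exact ContinuousAt.rpow_const (by fun_prop) (Or.inl (sub_pos.2 hbt₁).ne')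
  · exact fun r hr => hasDerivAt_rlConv_one_add_max_rpow hβ hκ hb (by linarith [hr.1])
  · intro y
    have h1 := hmin' t₁ ht₁ y
    exact (div_le_div_iff_of_pos_right (hwpos t₁ hbt₁)).1 h1
  · exact fun r hr => hbar r ⟨by linarith [hr.1], hr.2.trans ht₁.2⟩ x₁
  · intro r hr
    rw [add_zero]
    rcases le_total r b with hrb | hrb
    · exact (hmono1 ⟨hr.1, hrb⟩ ⟨hb, le_rfl⟩ hrb).trans
        (hmono2 ⟨le_rfl, hba⟩ ⟨hba, le_rfl⟩ hba)
    · exact hmono2 ⟨hrb, hr.2⟩ ⟨hba, le_rfl⟩ hr.2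

/-- A function whose Abel integral is a parabola starting at `a`. -/
noncomputable def parabolaBarrier (β a α S : ℝ) (r : ℝ) : ℝ :=
  α / beta β (2 - β) * (max (r - a) 0) ^ (1 - β)
    + -(S / (2 * beta β (3 - β))) * (max (r - a) 0) ^ (2 - β)

theorem continuous_parabolaBarrier (hβ1 : β < 1) (a α S : ℝ) :
    Continuous (parabolaBarrier β a α S) :=
  ((continuous_max_sub_rpow (by linarith) a).const_mul _).add
    ((continuous_max_sub_rpow (by linarith) a).const_mul _)

theorem rlConv_parabolaBarrier (hβ : 0 < β) (hβ1 : β < 1) {a α S t : ℝ} (ha : 0 ≤ a)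
    (ht : 0 ≤ t) :
    rlConv β 0 (parabolaBarrier β a α S) t = α * max (t - a) 0 - S / 2 * (max (t - a) 0) ^ 2 := by
  unfold parabolaBarrier
  rw [rlConv_add hβ ((continuous_max_sub_rpow (by linarith) a).const_mul _)
    ((continuous_max_sub_rpow (by linarith) a).const_mul _), rlConv_const_mul, rlConv_const_mul,
    rlConv_max_rpow hβ (by linarith) ha ht, rlConv_max_rpow hβ (by linarith) ha ht,
    show 1 - β + 1 = 2 - β by ring, show 2 - β + 1 = 3 - β by ring, add_sub_cancel,
    add_sub_cancel, Real.rpow_one, Real.rpow_two]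
  have h1 := (beta_pos (α := β) (β := 2 - β) hβ (by linarith)).ne'
  have h2 := (beta_pos (α := β) (β := 3 - β) hβ (by linarith)).ne'
  field_simp
  ring

theorem hasDerivAt_parabolaBarrier {a α S r : ℝ} (hr : a < r) :
    HasDerivAt (parabolaBarrier β a α S)
      (α / beta β (2 - β) * ((1 - β) * (r - a) ^ (-β))
        + -(S / (2 * beta β (3 - β))) * ((2 - β) * (r - a) ^ (1 - β))) r := by
  refine (((hasDerivAt_max_sub_rpow (p := 1 - β) hr).const_mul _).add
    ((hasDerivAt_max_sub_rpow (p := 2 - β) hr).const_mul _)).congr_deriv ?_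
  rw [show 1 - β - 1 = -β by ring, show 2 - β - 1 = 1 - β by ring]

theorem hasDerivAt_rlConv_parabolaBarrier (hβ : 0 < β) (hβ1 : β < 1) {a α S r : ℝ} (ha : 0 ≤ a)
    (hr : a < r) :
    HasDerivAt (rlConv β 0 (parabolaBarrier β a α S)) (α - S * (r - a)) r := by
  have h1 : HasDerivAt (fun t => α * (t - a) - S / 2 * (t - a) ^ 2) (α - S * (r - a)) r := by
    have h0 := (hasDerivAt_id' r).sub_const a
    refine ((h0.const_mul α).sub ((h0.pow 2).const_mul (S / 2))).congr_deriv ?_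
    simp only [Nat.cast_ofNat]
    ring
  refine h1.congr_of_eventuallyEq ?_
  filter_upwards [lt_mem_nhds hr] with y hy
  rw [rlConv_parabolaBarrier hβ hβ1 ha (ha.trans hy.le), max_eq_left (sub_pos.2 hy).le]

/-- The Abel integral of a nearly constant function is nearly monotone. -/
theorem rlConv_le_add_of_near {f : ℝ → ℝ} {c ε r a s : ℝ} (hβ : 0 < β) (hf : Continuous f)
    (hc : 0 ≤ c) (hε : 0 ≤ ε) (hr : 0 ≤ r) (hra : r ≤ a) (has : a ≤ s)
    (hfc : ∀ u ∈ Icc 0 s, |f u - c| ≤ ε) :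
    rlConv β 0 f r ≤ rlConv β 0 f a + 2 * ε * s ^ β / β := by
  have hi : ∀ (g : ℝ → ℝ), Continuous g → ∀ t,
      IntervalIntegrable (fun r => (t - r) ^ (β - 1) * g r) volume 0 t :=
    fun g hg t => intervalIntegrable_sub_rpow_mul hβ hg.continuousOn
  have h1 : rlConv β 0 f r ≤ rlConv β 0 (fun _ => c + ε) r := by
    refine intervalIntegral.integral_mono_on hr (hi f hf r) (hi _ continuous_const r) fun u hu => ?_
    refine mul_le_mul_of_nonneg_left ?_ (Real.rpow_nonneg (by linarith [hu.2]) _)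
    have := (abs_le.1 (hfc u ⟨hu.1, by linarith [hu.2]⟩)).2
    linarith
  have h2 : rlConv β 0 (fun _ => c - ε) a ≤ rlConv β 0 f a := by
    refine intervalIntegral.integral_mono_on (hr.trans hra) (hi _ continuous_const a) (hi f hf a)
      fun u hu => ?_
    refine mul_le_mul_of_nonneg_left ?_ (Real.rpow_nonneg (by linarith [hu.2]) _)
    have := (abs_le.1 (hfc u ⟨hu.1, by linarith [hu.2]⟩)).1
    linarith
  rw [rlConv_const hβ, sub_zero] at h1 h2
  have h3 : r ^ β ≤ a ^ β := Real.rpow_le_rpow hr hra hβ.le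
  have h4 : a ^ β ≤ s ^ β := Real.rpow_le_rpow (hr.trans hra) has hβ.le
  have h5 : (c + ε) * (r ^ β / β) ≤ (c - ε) * (a ^ β / β) + 2 * ε * s ^ β / β := by
    rw [← mul_div_assoc, ← mul_div_assoc, ← add_div]
    refine div_le_div_of_nonneg_right ?_ hβ.le
    nlinarith [mul_le_mul_of_nonneg_left h3 hc, mul_le_mul_of_nonneg_left h3 hε,
      mul_le_mul_of_nonneg_left h4 hε]
  linarith

/-- Bound for the negative part of `ν` weighted by the distance to a starting time. -/
theorem weighted_min_le (h : AbelMinimumPrinciple β T K m m' ν) (hβ : 0 < β) (hβ1 : β < 1)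
    {θ e ε t₀ t₁ s A : ℝ} {x : X} (hθ : 0 < θ) (hθ2 : θ ≤ 1 / 2) (he : 0 < e)
    (heθ : e ≤ (1 - β) / beta β (2 - β) - (2 - β) * θ / (2 * beta β (3 - β)))
    (ht₀ : 0 < t₀) (ht : t₀ < t₁) (hts : t₁ ≤ s) (hs : s < T) (hε : 0 ≤ ε)
    (hnear : ∀ u ∈ Icc 0 s, |m u x - m 0 x| ≤ ε)
    (hKe : K * (t₁ - t₀) ^ β ≤ e / 2) (hA : 0 < A)
    (hmin : ∀ y, ν t₁ x ≤ ν t₁ y)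
    (hbar : ∀ r ∈ Ioc t₀ t₁, -A ≤ (r - t₀) * ν r x) (hcon : (t₁ - t₀) * ν t₁ x = -A) :
    beta (1 - β) β * (A * (e / 2)) ≤ 2 * ε * s ^ β * (θ / 2) ^ (-β - 1) := by
  set D := t₁ - t₀ with hD
  have hD0 : 0 < D := sub_pos.2 ht
  set a := t₁ - θ * D with ha
  have hθD : 0 < θ * D := mul_pos hθ hD0
  have hθ1 : 0 < 1 - θ := by linarith
  have hat₀ : a - t₀ = (1 - θ) * D := by rw [ha, hD]; ring
  have hat₀' : 0 < a - t₀ := hat₀ ▸ mul_pos hθ1 hD0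
  set α := 1 / ((1 - θ) * D) with hα
  set S := α / D with hS
  have hα0 : 0 < α := by positivity
  have hwt : α - S * (t₁ - a) = 1 / D := by
    rw [hS, hα, ha]
    field_simp
    ring
  have hB := beta_pos (α := 1 - β) (β := β) (by linarith) hβ
  have key := h.contact (g := parabolaBarrier β a α S)
    (g' := fun r => α / beta β (2 - β) * ((1 - β) * (r - a) ^ (-β))
        + -(S / (2 * beta β (3 - β))) * ((2 - β) * (r - a) ^ (1 - β)))
    (w := fun r => α - S * (r - a)) (n := 2 * ε * s ^ β / β)
    (x := x) (a := a) (t₁ := t₁) (A := A) hβ hβ1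
    (by linarith) (by linarith) (by linarith) (continuous_parabolaBarrier hβ1 a α S)
    (fun r hr => hasDerivAt_parabolaBarrier hr.1) ?_ (by fun_prop)
    (fun r hr => hasDerivAt_rlConv_parabolaBarrier hβ hβ1 (by linarith) hr.1) hA ?_ hmin ?_ ?_ ?_ ?_
  · have hta : t₁ - a = θ * D := by rw [ha]; ring
    rw [hwt, hta] at key
    have h1 : (θ * D) ^ (1 - β) = θ * D * (θ * D) ^ (-β) := by
      rw [sub_eq_add_neg, Real.rpow_add hθD, Real.rpow_one]
    have h2 : α / beta β (2 - β) * ((1 - β) * (θ * D) ^ (-β))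
        + -(S / (2 * beta β (3 - β))) * ((2 - β) * (θ * D) ^ (1 - β))
        = α * (θ * D) ^ (-β)
          * ((1 - β) / beta β (2 - β) - (2 - β) * θ / (2 * beta β (3 - β))) := by
      rw [h1, hS]
      field_simp
      ring
    have h3 : D ^ (-β) ≤ (θ * D) ^ (-β) :=
      Real.rpow_le_rpow_of_nonpos hθD (by nlinarith) (by linarith)
    have h4 : 1 / D ≤ α := by
      rw [hα]
      exact one_div_le_one_div_of_le (by positivity) (by nlinarith)
    have hDβ : 0 < D ^ (-β) := Real.rpow_pos_of_pos hD0 _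
    have h5 : 1 / D * D ^ (-β) * e ≤ α * (θ * D) ^ (-β)
          * ((1 - β) / beta β (2 - β) - (2 - β) * θ / (2 * beta β (3 - β))) := by
      gcongr
    have h6 : K * (1 / D) ≤ 1 / D * D ^ (-β) * (e / 2) := by
      have h61 : D ^ β * D ^ (-β) = 1 := by rw [← Real.rpow_add hD0, add_neg_cancel, Real.rpow_zero]
      have h62 : K * (1 / D) = 1 / D * D ^ (-β) * (K * D ^ β) := by
        linear_combination -K * (1 / D) * h61
      rw [h62]
      gcongr
    rw [h2] at key
    have h7 : beta (1 - β) β * (A * (1 / D * D ^ (-β) * (e / 2))) ≤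
        2 * ε * s ^ β / β * (β * (θ * D / 2) ^ (-β - 1)) := by
      refine le_trans ?_ key
      refine mul_le_mul_of_nonneg_left (mul_le_mul_of_nonneg_left ?_ hA.le) hB.le
      linarith
    have h8 : 1 / D * D ^ (-β) = D ^ (-β - 1) := by
      rw [Real.rpow_sub_one hD0.ne']
      ring
    have h9 : (θ * D / 2) ^ (-β - 1) = (θ / 2) ^ (-β - 1) * D ^ (-β - 1) := by
      rw [← Real.mul_rpow (by positivity) hD0.le]
      ring_nf
    rw [h8, h9] at h7
    refine le_of_mul_le_mul_right ?_ (Real.rpow_pos_of_pos hD0 (-β - 1))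
    refine le_trans (le_of_eq (by ring)) (h7.trans (le_of_eq ?_))
    field_simp
  · have hta : t₁ - a ≠ 0 := by rw [ha, sub_sub_cancel]; exact hθD.ne'
    refine ContinuousAt.continuousWithinAt ?_
    have hp : ∀ p : ℝ, ContinuousAt (fun r => (r - a) ^ p) t₁ := fun p =>
      (continuousAt_id.sub continuousAt_const).rpow_const (Or.inl hta)
    exact (continuousAt_const.mul (continuousAt_const.mul (hp (-β)))).add
      (continuousAt_const.mul (continuousAt_const.mul (hp (1 - β))))
  · simp only [hwt]
    positivity
  · intro r hr
    have hr0 : 0 < r - t₀ := by linarith [hr.1]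
    have h1 := hbar r ⟨by linarith, hr.2⟩
    have h2 : 1 ≤ (α - S * (r - a)) * (r - t₀) := by
      have h3 : α - S * (r - a) = (D - (r - a)) / ((1 - θ) * D * D) := by
        rw [hS, hα]
        field_simp
      rw [h3, div_mul_eq_mul_div, one_le_div (by positivity)]
      have h4 : r - t₀ = (r - a) + (1 - θ) * D := by rw [← hat₀]; ring
      have h5 : r - a ≤ θ * D := by
        rw [ha]
        linarith [hr.2]
      rw [h4]
      nlinarith [mul_nonneg (sub_nonneg.2 hr.1) (sub_nonneg.2 h5)]
    have h6 : (r - t₀) * -(A * (α - S * (r - a))) ≤ (r - t₀) * ν r x := by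
      nlinarith
    exact le_of_mul_le_mul_left h6 hr0
  · simp only [hwt]
    rw [mul_one_div, ← neg_div, ← hcon, mul_div_cancel_left₀ _ hD0.ne']
  · have : 0 < s := by linarith
    positivity
  · intro r hr
    have hra : max (r - a) 0 = 0 := max_eq_right (by linarith [hr.2])
    have h1 : rlConv β 0 (parabolaBarrier β a α S) r = 0 := by
      rw [rlConv_parabolaBarrier hβ hβ1 (by linarith) hr.1, hra]
      ring
    have h2 : rlConv β 0 (parabolaBarrier β a α S) a = 0 := by
      rw [rlConv_parabolaBarrier hβ hβ1 (by linarith) (by linarith), sub_self, max_self]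
      ring
    rw [h1, h2, mul_zero, add_zero, add_zero]
    exact rlConv_le_add_of_near hβ (h.continuous_time x) (h.init_nonneg x) hε hr.1 hr.2
      (by linarith) hnear

/-- The negative part of `ν` is `o(t ^ (β - 1))` as `t → 0`. -/
theorem initial_layer [CompactSpace X] (h : AbelMinimumPrinciple β T K m m' ν) (hβ : 0 < β)
    (hβ1 : β < 1) :
    ∀ ε > 0, ∃ η > 0, ∀ t ∈ Ioo 0 η, t < T → ∀ x, -(ε * t ^ (β - 1)) ≤ ν t x := by
  intro ε hε
  have hc1 := beta_pos (α := β) (β := 2 - β) hβ (by linarith)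
  have hc2 := beta_pos (α := β) (β := 3 - β) hβ (by linarith)
  have hB := beta_pos (α := 1 - β) (β := β) (by linarith) hβ
  set e := (1 - β) / beta β (2 - β) / 2 with he
  have he0 : 0 < e := by
    have : 0 < 1 - β := by linarith
    positivity
  set q := (2 - β) / (2 * beta β (3 - β)) with hq
  have hq0 : 0 < q := by
    have : 0 < 2 - β := by linarith
    positivity
  set θ := min (1 / 2) (e / q) with hθ
  have hθ0 : 0 < θ := by positivity
  have hθq : θ * q ≤ e := (le_div_iff₀ hq0).1 (min_le_right _ _)
  set P := (θ / 2) ^ (-β - 1) with hP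
  have hP0 : 0 < P := by positivity
  set ε' := ε * beta (1 - β) β * e / (8 * P) with hε'
  have hε'0 : 0 < ε' := by positivity
  have hev1 : ∀ᶠ u in 𝓝 (0 : ℝ), ∀ x ∈ (univ : Set X), |m u x - m 0 x| < ε' := by
    refine isCompact_univ.eventually_forall_of_forall_eventually fun x _ => ?_
    have hcont : Continuous fun p : ℝ × X => |m p.1 p.2 - m 0 p.2| :=
      (h.cont.sub (h.cont.comp (by fun_prop : Continuous fun p : ℝ × X => ((0 : ℝ), p.2)))).abs
    exact hcont.continuousAt.eventually_lt continuousAt_const (by simpa using hε'0)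
  have hev2 : ∀ᶠ u in 𝓝 (0 : ℝ), K * u ^ β < e / 2 := by
    have hcont : Continuous fun u : ℝ => K * u ^ β :=
      continuous_const.mul (Real.continuous_rpow_const hβ.le)
    refine hcont.continuousAt.eventually_lt continuousAt_const ?_
    rw [Real.zero_rpow hβ.ne']
    linarith
  obtain ⟨η, hη, hη'⟩ := Metric.eventually_nhds_iff.1 (hev1.and hev2)
  refine ⟨η, hη, fun s hs hsT x₀ => ?_⟩
  have hs0 : 0 < s := hs.1
  rcases le_or_gt 0 (ν s x₀) with hpos | hneg
  · exact le_trans (neg_nonpos.2 (by positivity)) hpos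
  set t₀ := s / 2 with ht₀
  have ht₀0 : 0 < t₀ := by positivity
  have hsub : Icc t₀ s ×ˢ (univ : Set X) ⊆ Ioo 0 T ×ˢ univ := fun p hp =>
    ⟨⟨ht₀0.trans_le hp.1.1, hp.1.2.trans_lt hsT⟩, mem_univ _⟩
  obtain ⟨⟨t₁, x₁⟩, ⟨ht₁, -⟩, hmin⟩ := (isCompact_Icc.prod isCompact_univ).exists_isMinOn
    (f := fun p : ℝ × X => (p.1 - t₀) * ν p.1 p.2) (s := Icc t₀ s ×ˢ univ)
    ⟨(s, x₀), ⟨by linarith, le_rfl⟩, mem_univ _⟩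
    ((by fun_prop : Continuous fun p : ℝ × X => p.1 - t₀).continuousOn.mul
      (h.continuousOn_abel.mono hsub))
  have hmin' : ∀ r ∈ Icc t₀ s, ∀ y, (t₁ - t₀) * ν t₁ x₁ ≤ (r - t₀) * ν r y := fun r hr y =>
    hmin (a := (r, y)) ⟨hr, mem_univ _⟩
  have hlt := hmin' s ⟨by linarith, le_rfl⟩ x₀
  have hst₀ : s - t₀ = s / 2 := by rw [ht₀]; ring
  rw [hst₀] at hlt
  have hA : (t₁ - t₀) * ν t₁ x₁ < 0 := hlt.trans_lt (mul_neg_of_pos_of_neg (by positivity) hneg)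
  have ht₀₁ : t₀ < t₁ := by
    refine lt_of_le_of_ne ht₁.1 fun h0 => ?_
    rw [← h0, sub_self, zero_mul] at hA
    exact lt_irrefl _ hA
  have hdist : ∀ u, 0 ≤ u → u ≤ s → dist u 0 < η := fun u hu hus => by
    rw [dist_zero_right, Real.norm_of_nonneg hu]
    exact hus.trans_lt hs.2
  have key := h.weighted_min_le hβ hβ1 (A := -((t₁ - t₀) * ν t₁ x₁)) (x := x₁) hθ0
    (min_le_left _ _) he0 ?_ ht₀0 ht₀₁ ht₁.2 hsT hε'0.le
    (fun u hu => ((hη' (hdist u hu.1 hu.2)).1 x₁ (mem_univ _)).le)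
    (hη' (hdist (t₁ - t₀) (by linarith) (by linarith [ht₁.2]))).2.le (by linarith) ?_ ?_
    (neg_neg _).symm
  · have h1 : 2 * ε' * s ^ β * P = beta (1 - β) β * (ε * s ^ β / 2 * (e / 2)) := by
      rw [hε']
      field_simp
      ring
    rw [← hP, h1] at key
    have h2 := le_of_mul_le_mul_right (le_of_mul_le_mul_left key hB) (half_pos he0)
    have h3 : s * -(ε * s ^ (β - 1)) ≤ s * ν s x₀ := by
      have h4 : s * s ^ (β - 1) = s ^ β := by
        rw [Real.rpow_sub_one hs0.ne']
        field_simp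
      linear_combination 2 * h2 + 2 * hlt - ε * h4
    exact le_of_mul_le_mul_left h3 hs0
  · have h1 : (2 - β) * θ / (2 * beta β (3 - β)) = θ * q := by rw [hq]; ring
    rw [h1]
    linarith
  · exact fun y => le_of_mul_le_mul_left (hmin' t₁ ht₁ y) (sub_pos.2 ht₀₁)
  · intro r hr
    rw [neg_neg]
    exact hmin' r ⟨hr.1.le, hr.2.trans ht₁.2⟩ x₁

/-- Minimum principle: `ν` is nonnegative. -/
theorem nonneg [CompactSpace X] (h : AbelMinimumPrinciple β T K m m' ν) (hβ : 0 < β)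
    (hβ1 : β < 1) (hK : 0 ≤ K) {t : ℝ} (ht : t ∈ Ioo 0 T) (x : X) : 0 ≤ ν t x := by
  have hκ : 0 < β * (1 - β) := mul_pos hβ (by linarith)
  obtain ⟨τ, hτ, hτ'⟩ := exists_step_length (C := beta β (β * (1 - β) + 1) * (β + β * (1 - β)))
    hκ hβ (by nlinarith) K
  have hstep : ∀ n : ℕ, ∀ s ∈ Ioc 0 (n * τ), s < T → ∀ y, 0 ≤ ν s y := by
    intro n
    induction n with
    | zero =>
      intro s hs
      simp only [Nat.cast_zero, zero_mul, Ioc_self, mem_empty_iff_false] at hs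
    | succ n ih =>
      have hn : 0 ≤ n * τ := by positivity
      have hnext := h.nonneg_step hβ hβ1 (b := n * τ) hκ hτ' hK hn
        (fun s hs => ih s ⟨hs.1, hs.2.le⟩) ?_
      · intro s hs hsT
        rcases le_or_gt s (n * τ) with hsn | hsn
        · exact ih s ⟨hs.1, hsn⟩ hsT
        · refine hnext s ⟨hsn, ?_⟩ hsT
          have := hs.2
          push_cast at this
          linarith
      · rcases hn.eq_or_lt with h0 | h0
        · rw [← h0]
          simpa using h.initial_layer hβ hβ1
        · intro ε hε
          rcases le_or_gt T (n * τ) with hT | hT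
          · exact ⟨1, one_pos, fun s hs hsT => absurd (hs.1.trans hsT) (not_lt.2 hT)⟩
          have hmem : n * τ ∈ Ioo 0 T := ⟨h0, hT⟩
          have hev : ∀ᶠ s in 𝓝 (n * τ), ∀ y ∈ (univ : Set X), -(ε * s ^ (β - 1)) < ν s y := by
            refine isCompact_univ.eventually_forall_of_forall_eventually fun y _ => ?_
            refine ContinuousAt.eventually_lt ?_ (h.continuousOn_abel.continuousAt
              (prod_mem_nhds (isOpen_Ioo.mem_nhds hmem) univ_mem)) ?_
            · exact (continuousAt_const.mul
                (continuousAt_fst.rpow_const (Or.inl h0.ne'))).neg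
            · exact lt_of_lt_of_le (neg_neg_of_pos (mul_pos hε (Real.rpow_pos_of_pos h0 _)))
                (ih _ ⟨h0, le_rfl⟩ hT y)
          obtain ⟨δ, hδ, hδ'⟩ := Metric.eventually_nhds_iff.1 hev
          refine ⟨δ, hδ, fun s hs hsT y => (hδ' ?_ y (mem_univ _)).le⟩
          rw [Real.dist_eq, abs_lt]
          constructor <;> linarith [hs.1, hs.2]
  obtain ⟨n, hn⟩ := exists_nat_ge (t / τ)
  exact hstep n t ⟨ht.1, (div_le_iff₀ hτ).1 hn⟩ ht.2 x

end AbelMinimumPrinciple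

end MinimumPrinciple

section FokkerPlanck

open Filter Topology ProbabilityTheory

theorem deriv_deriv_nonneg_of_isLocalMin {g : ℝ → ℝ} {x : ℝ} (hg : ContinuousAt g x)
    (hmin : IsLocalMin g x) : 0 ≤ deriv (deriv g) x := by
  by_contra! hneg
  have hmax := isLocalMax_of_deriv_deriv_neg hneg hmin.deriv_eq_zero hg
  have hconst : g =ᶠ[𝓝 x] fun _ => g x := by
    filter_upwards [hmin, hmax] with y h1 h2
    exact le_antisymm h2 h1
  have h := hconst.deriv.deriv_eq
  simp only [deriv_const', deriv_const] at h
  exact hneg.ne h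

/-- At a negative local minimum of `q`, the product with an `L`-Lipschitz function has derivative
bounded below. -/
theorem le_deriv_mul_of_isLocalMin {p q : ℝ → ℝ} {x : ℝ} {L : NNReal} (hp : LipschitzWith L p)
    (hq : ContinuousAt q x) (hmin : IsLocalMin q x) (hneg : q x < 0) :
    L * q x ≤ deriv (fun s => p s * q s) x := by
  by_cases hd : DifferentiableAt ℝ (fun s => p s * q s) x
  swap
  · rw [deriv_zero_of_not_differentiableAt hd]
    exact mul_nonpos_of_nonneg_of_nonpos L.2 hneg.le
  have hlim := hasDerivAt_iff_tendsto_slope.1 hd.hasDerivAt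
  have hlip : ∀ s, |p s - p x| ≤ L * |s - x| := fun s => by
    simpa only [Real.dist_eq] using hp.dist_le_mul s x
  rcases le_or_gt 0 (p x) with hpx | hpx
  · have hlim' : Tendsto (slope (fun s => p s * q s) x) (𝓝[>] x)
        (𝓝 (deriv (fun s => p s * q s) x)) :=
      hlim.mono_left (nhdsWithin_mono x fun s hs => ne_of_gt hs)
    rcases hpx.eq_or_lt with h0 | h0
    · have hq' : Tendsto (fun s => L * q s) (𝓝[>] x) (𝓝 (L * q x)) :=
        (hq.tendsto.mono_left nhdsWithin_le_nhds).const_mul _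
      refine le_of_tendsto_of_tendsto hq' hlim' ?_
      filter_upwards [self_mem_nhdsWithin,
        nhdsWithin_le_nhds (hq.eventually_lt continuousAt_const hneg)] with s hs hqs
      have hsx : 0 < s - x := sub_pos.2 hs
      rw [slope_def_field, ← h0, zero_mul, sub_zero, le_div_iff₀ hsx]
      have := (abs_le.1 (hlip s)).2
      rw [← h0, sub_zero, abs_of_pos hsx] at this
      nlinarith
    · refine ge_of_tendsto hlim' ?_
      filter_upwards [self_mem_nhdsWithin, nhdsWithin_le_nhds hmin,
        nhdsWithin_le_nhds (continuousAt_const.eventually_lt hp.continuous.continuousAt h0)]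
        with s hs hqs hps
      have hsx : 0 < s - x := sub_pos.2 hs
      rw [slope_def_field, le_div_iff₀ hsx]
      have := (abs_le.1 (hlip s)).2
      rw [abs_of_pos hsx] at this
      nlinarith [mul_nonneg hps.le (sub_nonneg.2 hqs)]
  · have hlim' : Tendsto (slope (fun s => p s * q s) x) (𝓝[<] x)
        (𝓝 (deriv (fun s => p s * q s) x)) :=
      hlim.mono_left (nhdsWithin_mono x fun s hs => ne_of_lt hs)
    refine ge_of_tendsto hlim' ?_
    filter_upwards [self_mem_nhdsWithin, nhdsWithin_le_nhds hmin,
      nhdsWithin_le_nhds (hp.continuous.continuousAt.eventually_lt continuousAt_const hpx)]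
      with s hs hqs hps
    have hsx : s - x < 0 := sub_neg.2 hs
    rw [slope_def_field, le_div_iff_of_neg hsx]
    have := (abs_le.1 (hlip s)).1
    rw [abs_of_neg hsx] at this
    nlinarith [mul_nonneg (neg_nonneg.2 hps.le) (sub_nonneg.2 hqs)]

theorem isLocalMin_update {d : ℕ} {q : (Fin d → ℝ) → ℝ} {x : Fin d → ℝ} (hmin : ∀ y, q x ≤ q y)
    (i : Fin d) : IsLocalMin (fun s => q (Function.update x i s)) (x i) :=
  Eventually.of_forall fun s => by
    simpa only [Function.update_eq_self] using hmin (Function.update x i s)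

theorem lapl_nonneg_of_forall_le {d : ℕ} {q : (Fin d → ℝ) → ℝ} (hq : Continuous q)
    {x : Fin d → ℝ} (hmin : ∀ y, q x ≤ q y) : 0 ≤ lapl q x := by
  refine Finset.sum_nonneg fun i _ => ?_
  have hg : Continuous fun s => q (Function.update x i s) :=
    hq.comp (continuous_const.update i continuous_id)
  have h := deriv_deriv_nonneg_of_isLocalMin hg.continuousAt (isLocalMin_update hmin i)
  have hfun : (fun s => pderiv q i (Function.update x i s)) =
      deriv fun s => q (Function.update x i s) := by
    ext s
    simp only [pderiv, Function.update_idem, Function.update_self]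
  rwa [← hfun] at h

theorem le_diverg_of_forall_le {d : ℕ} {V : (Fin d → ℝ) → Fin d → ℝ} {L : NNReal}
    (hV : LipschitzWith L V) {q : (Fin d → ℝ) → ℝ} (hq : Continuous q)
    {x : Fin d → ℝ} (hmin : ∀ y, q x ≤ q y) (hneg : q x < 0) :
    d * L * q x ≤ diverg (fun y i => V y i * q y) x := by
  have h : ∀ i ∈ Finset.univ, L * q x ≤ pderiv (fun y => V y i * q y) i x := by
    intro i _
    have hg : Continuous fun s => q (Function.update x i s) :=
      hq.comp (continuous_const.update i continuous_id)
    have hp : LipschitzWith L fun s => V (Function.update x i s) i := by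
      refine LipschitzWith.of_dist_le_mul fun s s' => (dist_le_pi_dist _ _ i).trans ?_
      refine (hV.dist_le_mul _ _).trans (mul_le_mul_of_nonneg_left ?_ L.2)
      refine (dist_pi_le_iff dist_nonneg).2 fun j => ?_
      rcases eq_or_ne j i with rfl | hj
      · simp
      · simp [hj, dist_nonneg]
    simpa only [Function.update_eq_self, pderiv] using le_deriv_mul_of_isLocalMin hp hg.continuousAt
      (isLocalMin_update hmin i) (by simpa only [Function.update_eq_self] using hneg)
  calc (d : ℝ) * L * q x = ∑ _i : Fin d, L * q x := by simp [mul_assoc]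
    _ ≤ _ := Finset.sum_le_sum h

theorem rlInt_eq {β t : ℝ} (ht : 0 ≤ t) (φ : ℝ → ℝ) :
    rlInt β φ t = (Real.Gamma β)⁻¹ * rlConv β 0 φ t := by
  rw [rlInt, rlConv, intervalIntegral.integral_of_le ht, integral_Ioc_eq_integral_Ioo]

theorem ZPeriodic.exists_mem_Icc {d : ℕ} (x : Fin d → ℝ) :
    ∃ y ∈ Icc (0 : Fin d → ℝ) 1, ∀ g : (Fin d → ℝ) → ℝ, ZPeriodic g → g x = g y := by
  refine ⟨fun i => Int.fract (x i), ⟨fun i => Int.fract_nonneg _,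
    fun i => (Int.fract_lt_one _).le⟩, fun g hg => ?_⟩
  rw [← hg (fun i => ⌊x i⌋) fun i => Int.fract (x i)]
  congr 1
  ext i
  simp only [Pi.add_apply, Int.fract_add_floor]

namespace IsFPSolution

variable {β T : ℝ} {d : ℕ} {v : ℝ → (Fin d → ℝ) → Fin d → ℝ} {m : ℝ → (Fin d → ℝ) → ℝ}

theorem zPeriodic_fracD (hm : IsFPSolution β T v m) (t : ℝ) : ZPeriodic (fracD β m t) := by
  intro z x
  have h : (fun τ => m τ (x + fun i => (z i : ℝ))) = fun τ => m τ x :=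
    funext fun τ => hm.periodic τ z x
  simp only [fracD, h]

theorem continuous_fracD (hm : IsFPSolution β T v m) {t : ℝ} (ht : t ∈ Ioo 0 T) :
    Continuous (fracD β m t) :=
  hm.mu_cont.comp_continuous (by fun_prop : Continuous fun x : Fin d → ℝ => (t, x))
    fun _ => ⟨ht, mem_univ _⟩

theorem hasDerivAt_rlConv (hm : IsFPSolution β T v m) (hβ : 0 < β) {t : ℝ} (ht : t ∈ Ioo 0 T)
    (x : Fin d → ℝ) :
    HasDerivAt (rlConv β 0 fun s => m s x) (Real.Gamma β * fracD β m t x) t := by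
  have hΓ := (Real.Gamma_pos_of_pos hβ).ne'
  refine ((hm.mu_exists x t ht).hasDerivAt.const_mul (Real.Gamma β)).congr_of_eventuallyEq ?_
  filter_upwards [lt_mem_nhds ht.1] with s hs
  rw [rlInt_eq hs.le, mul_inv_cancel_left₀ hΓ]

theorem le_deriv_of_forall_le (hm : IsFPSolution β T v m) {L : NNReal} {t : ℝ}
    (ht : t ∈ Ioo 0 T) (hv : LipschitzWith L (v t)) {x : Fin d → ℝ}
    (hmin : ∀ y, fracD β m t x ≤ fracD β m t y) (hneg : fracD β m t x < 0) :
    d * L * fracD β m t x ≤ deriv (fun s => m s x) t := by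
  have hc := hm.continuous_fracD ht
  rw [hm.eqn t ht x]
  linarith [lapl_nonneg_of_forall_le hc hmin, le_diverg_of_forall_le hv hc hmin hneg]

theorem abelMinimumPrinciple (hm : IsFPSolution β T v m) (hβ : 0 < β) {L : NNReal}
    (hv : ∀ t ∈ Icc (0 : ℝ) T, LipschitzWith L (v t)) (hm0 : ∀ x, 0 ≤ m 0 x) :
    AbelMinimumPrinciple (X := Icc (0 : Fin d → ℝ) 1) β T (d * L / Real.Gamma β)
      (fun t x => m t x) (fun t x => deriv (fun s => m s x) t)
      (fun t x => Real.Gamma β * fracD β m t x) where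
  cont := hm.cont.comp (by fun_prop :
    Continuous fun p : ℝ × Icc (0 : Fin d → ℝ) 1 => (p.1, (p.2 : Fin d → ℝ)))
  hasDerivAt x t ht := (hm.tdiff x t ht).hasDerivAt
  continuousOn_deriv x := hm.tderiv_cont.comp
    (by fun_prop : Continuous fun t : ℝ => (t, (x : Fin d → ℝ))).continuousOn
    fun _ ht => ⟨ht, mem_univ _⟩
  hasDerivAt_abel x t ht := hm.hasDerivAt_rlConv hβ ht x
  continuousOn_abel := continuousOn_const.mul (hm.mu_cont.comp (by fun_prop :
    Continuous fun p : ℝ × Icc (0 : Fin d → ℝ) 1 => (p.1, (p.2 : Fin d → ℝ))).continuousOn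
    fun _ hp => ⟨hp.1, mem_univ _⟩)
  lower_bound t ht x hmin hneg := by
    have hΓ := Real.Gamma_pos_of_pos hβ
    rw [← mul_assoc, div_mul_cancel₀ _ hΓ.ne']
    refine hm.le_deriv_of_forall_le ht (hv t (Ioo_subset_Icc_self ht)) (fun y => ?_)
      (neg_of_mul_neg_right hneg hΓ.le)
    obtain ⟨y', hy', hyy'⟩ := ZPeriodic.exists_mem_Icc y
    rw [hyy' _ (hm.zPeriodic_fracD t)]
    exact le_of_mul_le_mul_left (hmin ⟨y', hy'⟩) hΓ
  init_nonneg x := hm0 x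

end IsFPSolution

end FokkerPlanck

/-- Nonnegativity of the fractional derivative of the density:
if `v` is continuous, `ℤ^d`-periodic in `x` and Lipschitz in `x` uniformly in `t`, `m`
is a classical solution on `[0,T]` of the time-fractional Fokker–Planck equation with
`m(0,·) ≥ 0` and `∫_{[0,1]^d} m(0,x) dx = 1`, then `D^{1-β}_{(0,t]} m(·,x)(t) ≥ 0` for all
`t ∈ (0,T)` and all `x`. -/
theorem fracFP_fracDeriv_nonneg
    (β T : ℝ) (d : ℕ) (hd : 1 ≤ d) (hβ : 0 < β) (hβ1 : β < 1) (hT : 0 < T)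
    (v : ℝ → (Fin d → ℝ) → Fin d → ℝ)
    (hv_cont : Continuous fun p : ℝ × (Fin d → ℝ) => v p.1 p.2)
    (hv_per : ∀ t i, ZPeriodic fun x => v t x i)
    (hv_lip : ∃ Lv : NNReal, ∀ t ∈ Set.Icc (0 : ℝ) T, LipschitzWith Lv (v t))
    (m : ℝ → (Fin d → ℝ) → ℝ)
    (hm : IsFPSolution β T v m)
    (hm0_nonneg : ∀ x, 0 ≤ m 0 x)
    (hm0_mass : ∫ x in Set.Icc (0 : Fin d → ℝ) 1, m 0 x = 1) :
    ∀ t ∈ Set.Ioo (0 : ℝ) T, ∀ x, 0 ≤ fracD β m t x := by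
  obtain ⟨L, hL⟩ := hv_lip
  intro t ht x
  have hΓ := Real.Gamma_pos_of_pos hβ
  obtain ⟨y, hy, hxy⟩ := ZPeriodic.exists_mem_Icc x
  have h := (hm.abelMinimumPrinciple hβ hL hm0_nonneg).nonneg hβ hβ1 (by positivity) ht ⟨y, hy⟩
  rw [hxy _ (hm.zPeriodic_fracD t)]
  exact nonneg_of_mul_nonneg_right h hΓ
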